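/- Let Ω ⊂ ℝ^N (N ≥ 2) be a smooth bounded open set, let m ≥ 1, n ≥ 1 and 1 < r ≤ N be integers, set t := m mod r, and let 1 < γ < ∞ and 1 < δ < ∞ satisfy (r−t)/γ + t/δ ≤ 1. Then there is a constant C such that for every u ∈ C^∞(Ω̄, ℝ^n): ‖u‖_{W^{m−m/r,r}(Ω)} ≤ C ( ‖u‖_{W^{m−[m/r],γ}(Ω)} + ‖u‖_{W^{m−[m/r]−1,δ}(Ω)} ); i.e., W^{m−[m/r],γ}(Ω,ℝ^n) ∩ W^{m−[m/r]−1,δ}(Ω,ℝ^n) embeds continuously into W^{m−m/r,r}(Ω,ℝ^n). Here [m/r] denotes the integer part of m/r. -/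

import Mathlib

open MeasureTheory Filter Topology Real

noncomputable section

abbrev Euc (N : ℕ) := EuclideanSpace ℝ (Fin N)

/-- The (full signed) determinant of an `m`-dimensional matrix of order `N^m`:
`det A = ∑_{τ_2,…,τ_m ∈ S_N} (∏_{s=2}^m sgn τ_s) ∏_{k=1}^N a_{k τ_2(k) ⋯ τ_m(k)}`. -/
def hyperDet {N : ℕ} : {m : ℕ} → ((Fin m → Fin N) → ℝ) → ℝ
  | 0, A => A finZeroElim
  | m + 1, A =>
      ∑ τ : Fin m → Equiv.Perm (Fin N),
        (∏ s, ((Equiv.Perm.sign (τ s) : ℤ) : ℝ)) *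
          ∏ k : Fin N, A (Fin.cons k fun s => τ s k)

/-- classical partial derivative `∂_i f`. -/
def pderiv' {N : ℕ} (i : Fin N) (f : Euc N → ℝ) : Euc N → ℝ :=
  fun x => fderiv ℝ f x (EuclideanSpace.single i 1)

/-- iterated partial derivative `∂_{l_1} ∂_{l_2} ⋯ f`. -/
def pderivList {N : ℕ} : List (Fin N) → (Euc N → ℝ) → Euc N → ℝ
  | [], f => f
  | i :: l, f => pderiv' i (pderivList l f)

/-- the `m`th-Jacobian `(β,α)`-minor `M^β_α(D^m u)` of `u : Ω → ℝ^n`, i.e. the hyper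
determinant of the `(m+1)`-dimensional matrix of order `r^{m+1}` with entries
`∂_{α^1_{l_1}} ⋯ ∂_{α^m_{l_m}} u^{β_{l_0}}`. -/
def jacMinor {N n : ℕ} (m r : ℕ) (β : Fin r → Fin n) (α : Fin m → Fin r → Fin N)
    (u : Euc N → Fin n → ℝ) (x : Euc N) : ℝ :=
  hyperDet (m := m + 1) fun l : Fin (m + 1) → Fin r =>
    pderivList (List.ofFn fun s : Fin m => α s (l s.succ)) (fun y => u y (β (l 0))) x

/-- the `m`th-Jacobian `α`-minor `M_α(D^m v)` of a scalar function `v`. -/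
def scalMinor {N : ℕ} (m r : ℕ) (α : Fin m → Fin r → Fin N)
    (v : Euc N → ℝ) (x : Euc N) : ℝ :=
  hyperDet (m := m) fun l : Fin m → Fin r =>
    pderivList (List.ofFn fun s : Fin m => α s (l s)) v x

/-- the integer Sobolev norm `‖u‖_{W^{k,p}(Ω)} = ∑_{j ≤ k} ‖D^j u‖_{L^p(Ω)}`. -/
def intSobNorm {N : ℕ} {F : Type*} [NormedAddCommGroup F] [NormedSpace ℝ F]
    (Ω : Set (Euc N)) (k : ℕ) (p : ℝ) (u : Euc N → F) : ℝ :=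
  ∑ j ∈ Finset.range (k + 1), (∫ x in Ω, ‖iteratedFDeriv ℝ j u x‖ ^ p) ^ (1 / p)

open Classical in
/-- the (possibly fractional) Sobolev norm `‖u‖_{W^{s,p}(Ω)}`: for integer `s` the usual
Sobolev norm, for non-integer `s` the `W^{[s],p}` norm plus the Gagliardo seminorm of
`D^{[s]} u` with fractional exponent `s - [s]`. -/
def sobNorm {N : ℕ} {F : Type*} [NormedAddCommGroup F] [NormedSpace ℝ F]
    (Ω : Set (Euc N)) (s p : ℝ) (u : Euc N → F) : ℝ :=
  if ∃ k : ℕ, s = k then intSobNorm Ω ⌊s⌋₊ p u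
  else
    intSobNorm Ω ⌊s⌋₊ p u +
      (∫ x in Ω, ∫ y in Ω,
          ‖iteratedFDeriv ℝ ⌊s⌋₊ u x - iteratedFDeriv ℝ ⌊s⌋₊ u y‖ ^ p /
            ‖x - y‖ ^ ((N : ℝ) + (s - ⌊s⌋₊) * p)) ^ (1 / p)

/-- `‖D^m ψ‖_{L^∞}`, the sup of the `m`-th derivatives of `ψ`. -/
def supDm {N : ℕ} (m : ℕ) (ψ : Euc N → ℝ) : ℝ := ⨆ x, ‖iteratedFDeriv ℝ m ψ x‖

/-- `ψ ∈ C_c^∞(Ω)`. -/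
def IsCinfc {N : ℕ} (Ω : Set (Euc N)) (ψ : Euc N → ℝ) : Prop :=
  ContDiff ℝ (⊤ : ℕ∞) ψ ∧ HasCompactSupport ψ ∧ tsupport ψ ⊆ Ω

/-- `Ω` is a smooth bounded open subset of `ℝ^N`. -/
def IsSmoothDomain {N : ℕ} (Ω : Set (Euc N)) : Prop :=
  IsOpen Ω ∧ Bornology.IsBounded Ω ∧
    ∃ f : Euc N → ℝ, ContDiff ℝ (⊤ : ℕ∞) f ∧ Ω = {x | f x < 0} ∧
      ∀ x ∈ frontier Ω, fderiv ℝ f x ≠ 0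

section MaximalFunction

open Metric ENNReal Module

variable {E : Type*} [NormedAddCommGroup E] [NormedSpace ℝ E] [FiniteDimensional ℝ E]
  [MeasurableSpace E] [BorelSpace E]

/-- The centred Hardy–Littlewood maximal function over the radii `R / 2 ^ k`. -/
def dyadicMaximal (μ : Measure E) (R : ℝ) (g : E → ℝ≥0∞) (x : E) : ℝ≥0∞ :=
  ⨆ k : ℕ, (μ (closedBall (0 : E) (R / 2 ^ k)))⁻¹ * ∫⁻ z in closedBall x (R / 2 ^ k), g z ∂μ

variable (μ : Measure E) [μ.IsAddHaarMeasure]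

theorem measurable_dyadicMaximal (R : ℝ) {g : E → ℝ≥0∞} (hg : Measurable g) :
    Measurable (dyadicMaximal μ R g) := by
  refine Measurable.iSup fun k => Measurable.const_mul ?_ _
  have h : ∀ x : E, ∫⁻ z in closedBall x (R / 2 ^ k), g z ∂μ =
      ∫⁻ z, {p : E × E | dist p.2 p.1 ≤ R / 2 ^ k}.indicator (fun p => g p.2) (x, z) ∂μ := by
    intro x
    rw [← lintegral_indicator measurableSet_closedBall]
    rfl
  simp_rw [h]
  refine Measurable.lintegral_prod_right' ?_
  exact (hg.comp measurable_snd).indicator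
    (measurableSet_le (measurable_snd.dist measurable_fst) measurable_const)

theorem dyadicMaximal_le_of_le {R : ℝ} (hR : 0 < R) {g : E → ℝ≥0∞} {B : ℝ≥0∞}
    (hg : ∀ x, g x ≤ B) (x : E) : dyadicMaximal μ R g x ≤ B := by
  refine iSup_le fun k => ?_
  have hpos : 0 < R / 2 ^ k := by positivity
  have h0 : μ (closedBall (0 : E) (R / 2 ^ k)) ≠ 0 := (measure_closedBall_pos μ _ hpos).ne'
  have h1 : μ (closedBall (0 : E) (R / 2 ^ k)) ≠ ∞ := measure_closedBall_lt_top.ne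
  calc (μ (closedBall (0 : E) (R / 2 ^ k)))⁻¹ * ∫⁻ z in closedBall x (R / 2 ^ k), g z ∂μ
      ≤ (μ (closedBall (0 : E) (R / 2 ^ k)))⁻¹ * ∫⁻ _ in closedBall x (R / 2 ^ k), B ∂μ := by
        gcongr; exact hg _
    _ = B := by
        rw [setLIntegral_const, Measure.addHaar_closedBall_center μ x, mul_comm B, ← mul_assoc,
          ENNReal.inv_mul_cancel h0 h1, one_mul]

theorem lintegral_closedBall_le_dyadicMaximal {R : ℝ} (g : E → ℝ≥0∞) (x : E) {ρ : ℝ}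
    (hρ : 0 < ρ) (hρR : ρ ≤ R) :
    ∫⁻ z in closedBall x ρ, g z ∂μ ≤
      ENNReal.ofReal (2 ^ finrank ℝ E) * μ (closedBall (0 : E) ρ) * dyadicMaximal μ R g x := by
  have hR : 0 < R := hρ.trans_le hρR
  obtain ⟨k, hk1, hk2⟩ := exists_nat_pow_near (one_le_div hρ |>.2 hρR) (one_lt_two)
  have hpos : 0 < R / 2 ^ k := by positivity
  have hle : ρ ≤ R / 2 ^ k := by
    rw [le_div_iff₀ hρ] at hk1
    rw [le_div_iff₀ (by positivity)]; linarith
  have hle2 : R / 2 ^ k ≤ 2 * ρ := by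
    rw [div_lt_iff₀ hρ] at hk2
    rw [div_le_iff₀ (by positivity)]; rw [pow_succ] at hk2; linarith
  have h0 : μ (closedBall (0 : E) (R / 2 ^ k)) ≠ 0 := (measure_closedBall_pos μ _ hpos).ne'
  have h1 : μ (closedBall (0 : E) (R / 2 ^ k)) ≠ ∞ := measure_closedBall_lt_top.ne
  calc ∫⁻ z in closedBall x ρ, g z ∂μ
      ≤ ∫⁻ z in closedBall x (R / 2 ^ k), g z ∂μ :=
        lintegral_mono_set (closedBall_subset_closedBall hle)
    _ = μ (closedBall (0 : E) (R / 2 ^ k)) * ((μ (closedBall (0 : E) (R / 2 ^ k)))⁻¹ *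
          ∫⁻ z in closedBall x (R / 2 ^ k), g z ∂μ) := by
        rw [← mul_assoc, ENNReal.mul_inv_cancel h0 h1, one_mul]
    _ ≤ μ (closedBall (0 : E) (2 * ρ)) * dyadicMaximal μ R g x := by
        gcongr
        exact le_iSup (fun k : ℕ => (μ (closedBall (0 : E) (R / 2 ^ k)))⁻¹ *
          ∫⁻ z in closedBall x (R / 2 ^ k), g z ∂μ) k
    _ = _ := by rw [Measure.addHaar_closedBall_mul μ 0 zero_le_two hρ.le]

/-- The weak type `(1, 1)` estimate for the maximal function. -/
theorem mul_measure_dyadicMaximal_le {R : ℝ} (hR : 0 < R) (g : E → ℝ≥0∞) (c : ℝ≥0∞) :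
    c * μ {x | c < dyadicMaximal μ R g x} ≤
      ENNReal.ofReal (4 ^ finrank ℝ E) * ∫⁻ z, g z ∂μ := by
  set S := {x | c < dyadicMaximal μ R g x} with hS
  have hex : ∀ x ∈ S, ∃ k : ℕ, c * μ (closedBall x (R / 2 ^ k)) ≤
      ∫⁻ z in closedBall x (R / 2 ^ k), g z ∂μ := by
    intro x hx
    obtain ⟨k, hk⟩ := lt_iSup_iff.1 (show c < dyadicMaximal μ R g x from hx)
    refine ⟨k, ?_⟩
    have hpos : 0 < R / 2 ^ k := by positivity
    have h0 : μ (closedBall (0 : E) (R / 2 ^ k)) ≠ 0 := (measure_closedBall_pos μ _ hpos).ne'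
    have h1 : μ (closedBall (0 : E) (R / 2 ^ k)) ≠ ∞ := measure_closedBall_lt_top.ne
    rw [Measure.addHaar_closedBall_center μ x]
    rw [mul_comm, ← div_eq_mul_inv] at hk
    exact (ENNReal.le_div_iff_mul_le (.inl h0) (.inl h1)).1 hk.le
  choose! k hk using hex
  have hpos : ∀ x, 0 < R / 2 ^ k x := fun x => by positivity
  obtain ⟨u, huS, hdisj, hcov⟩ := Vitali.exists_disjoint_subfamily_covering_enlargement_closedBall
    S (fun x => x) (fun x => R / 2 ^ k x) R
    (fun x _ => div_le_self hR.le (one_le_pow₀ one_le_two)) 4 (by norm_num)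
  have hcount : u.Countable := hdisj.countable_of_nonempty_interior fun x _ =>
    ⟨x, ball_subset_interior_closedBall (mem_ball_self (hpos x))⟩
  have hsub : S ⊆ ⋃ x ∈ u, closedBall x (4 * (R / 2 ^ k x)) := by
    intro x hx
    obtain ⟨b, hb, hxb⟩ := hcov x hx
    exact Set.mem_biUnion hb (hxb (mem_closedBall_self (hpos x).le))
  have := hcount.to_subtype
  calc c * μ S ≤ c * ∑' x : u, μ (closedBall (x : E) (4 * (R / 2 ^ k x))) := by
        gcongr
        refine (measure_mono hsub).trans ?_
        exact measure_biUnion_le μ hcount _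
    _ = ENNReal.ofReal (4 ^ finrank ℝ E) *
          ∑' x : u, c * μ (closedBall (x : E) (R / 2 ^ k x)) := by
        rw [← ENNReal.tsum_mul_left, ← ENNReal.tsum_mul_left]
        refine tsum_congr fun x => ?_
        rw [Measure.addHaar_closedBall_mul μ _ (by norm_num) (hpos x).le,
          Measure.addHaar_closedBall_center μ (x : E)]
        ring
    _ ≤ ENNReal.ofReal (4 ^ finrank ℝ E) *
          ∑' x : u, ∫⁻ z in closedBall (x : E) (R / 2 ^ k x), g z ∂μ := by
        gcongr with x
        exact hk x (huS x.2)
    _ = ENNReal.ofReal (4 ^ finrank ℝ E) *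
          ∫⁻ z in ⋃ x ∈ u, closedBall (x : E) (R / 2 ^ k x), g z ∂μ := by
        rw [lintegral_biUnion hcount (fun x _ => measurableSet_closedBall) hdisj]
    _ ≤ _ := mul_le_mul' le_rfl (setLIntegral_le_lintegral _ _)

theorem dyadicMaximal_le_add {R : ℝ} (hR : 0 < R) (g : E → ℝ≥0∞) (c : ℝ≥0∞)
    (x : E) : dyadicMaximal μ R g x ≤ dyadicMaximal μ R ({z | c < g z}.indicator g) x + c := by
  refine iSup_le fun k => ?_
  have hpos : 0 < R / 2 ^ k := by positivity
  have h0 : μ (closedBall (0 : E) (R / 2 ^ k)) ≠ 0 := (measure_closedBall_pos μ _ hpos).ne'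
  have h1 : μ (closedBall (0 : E) (R / 2 ^ k)) ≠ ∞ := measure_closedBall_lt_top.ne
  calc (μ (closedBall (0 : E) (R / 2 ^ k)))⁻¹ * ∫⁻ z in closedBall x (R / 2 ^ k), g z ∂μ
      ≤ (μ (closedBall (0 : E) (R / 2 ^ k)))⁻¹ *
          ∫⁻ z in closedBall x (R / 2 ^ k), ({z | c < g z}.indicator g z + c) ∂μ := by
        gcongr with z
        by_cases h : c < g z
        · rw [Set.indicator_of_mem (show z ∈ {z | c < g z} from h)]; exact le_self_add
        · exact (not_lt.1 h).trans le_add_self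
    _ = (μ (closedBall (0 : E) (R / 2 ^ k)))⁻¹ *
          ∫⁻ z in closedBall x (R / 2 ^ k), {z | c < g z}.indicator g z ∂μ + c := by
        rw [lintegral_add_right _ measurable_const, mul_add, setLIntegral_const,
          Measure.addHaar_closedBall_center μ x, mul_comm c, ← mul_assoc,
          ENNReal.inv_mul_cancel h0 h1, one_mul]
    _ ≤ _ := by
        gcongr
        exact le_iSup (fun k : ℕ => (μ (closedBall (0 : E) (R / 2 ^ k)))⁻¹ *
          ∫⁻ z in closedBall x (R / 2 ^ k), {z | c < g z}.indicator g z ∂μ) k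

/-- The strong type `(p, p)` estimate for the maximal function of a bounded function. -/
theorem lintegral_dyadicMaximal_rpow_le {R : ℝ} (hR : 0 < R) {p : ℝ} (hp : 1 < p)
    {g : E → ℝ≥0∞} (hg : Measurable g) {B : ℝ≥0∞} (hB : B ≠ ∞) (hgB : ∀ x, g x ≤ B) :
    ∫⁻ x, dyadicMaximal μ R g x ^ p ∂μ ≤
      ENNReal.ofReal (p * (2 * 4 ^ finrank ℝ E) * (2 ^ (p - 1) / (p - 1))) *
        ∫⁻ x, g x ^ p ∂μ := by
  have hp0 : 0 < p := by linarith
  have hp1 : 0 < p - 1 := by linarith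
  have hM : ∀ x, dyadicMaximal μ R g x ≠ ∞ := fun x =>
    ((dyadicMaximal_le_of_le μ hR hgB x).trans_lt hB.lt_top).ne
  have hgf : ∀ x, g x ≠ ∞ := fun x => ((hgB x).trans_lt hB.lt_top).ne
  set C : ℝ := 4 ^ finrank ℝ E with hC
  have hC0 : 0 ≤ C := by positivity
  have hlevel : ∀ t : ℝ, 0 < t →
      μ {x | t < (dyadicMaximal μ R g x).toReal} * ENNReal.ofReal (t ^ (p - 1)) ≤
        ENNReal.ofReal (2 * C) *
          ((μ.withDensity g) {x | t < 2 * (g x).toReal} * ENNReal.ofReal (t ^ (p - 1 - 1))) := by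
    intro t ht
    have hset : {x | t < (dyadicMaximal μ R g x).toReal} ⊆
        {x | ENNReal.ofReal (t / 2) <
          dyadicMaximal μ R ({z | ENNReal.ofReal (t / 2) < g z}.indicator g) x} := by
      intro x hx
      have hx' : ENNReal.ofReal t < dyadicMaximal μ R g x :=
        (ENNReal.ofReal_lt_iff_lt_toReal ht.le (hM x)).2 hx
      have h2 := hx'.trans_le (dyadicMaximal_le_add μ hR g (ENNReal.ofReal (t / 2)) x)
      rw [show ENNReal.ofReal t = ENNReal.ofReal (t / 2) + ENNReal.ofReal (t / 2) by
        rw [← ENNReal.ofReal_add (by positivity) (by positivity)]; ring_nf] at h2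
      exact (ENNReal.add_lt_add_iff_right ENNReal.ofReal_ne_top).1 h2
    have hset2 : {x | t < 2 * (g x).toReal} = {x | ENNReal.ofReal (t / 2) < g x} := by
      ext x
      simp only [Set.mem_ofPred_eq]
      rw [ENNReal.ofReal_lt_iff_lt_toReal (by positivity) (hgf x)]
      constructor <;> intro h <;> linarith
    have hms : MeasurableSet {x | ENNReal.ofReal (t / 2) < g x} :=
      measurableSet_lt measurable_const hg
    have hweak := mul_measure_dyadicMaximal_le μ hR
      ({z | ENNReal.ofReal (t / 2) < g z}.indicator g) (ENNReal.ofReal (t / 2))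
    rw [lintegral_indicator hms, ← withDensity_apply _ hms] at hweak
    have hfac : ENNReal.ofReal (t ^ (p - 1)) =
        ENNReal.ofReal (t / 2) * (ENNReal.ofReal 2 * ENNReal.ofReal (t ^ (p - 1 - 1))) := by
      rw [← ENNReal.ofReal_mul zero_le_two, ← ENNReal.ofReal_mul (by positivity),
        Real.rpow_sub_one ht.ne' (p - 1)]
      congr 1
      field_simp
    calc μ {x | t < (dyadicMaximal μ R g x).toReal} * ENNReal.ofReal (t ^ (p - 1))
        ≤ μ {x | ENNReal.ofReal (t / 2) < dyadicMaximal μ R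
            ({z | ENNReal.ofReal (t / 2) < g z}.indicator g) x} *
            ENNReal.ofReal (t ^ (p - 1)) := by gcongr
      _ = (ENNReal.ofReal (t / 2) * μ {x | ENNReal.ofReal (t / 2) < dyadicMaximal μ R
            ({z | ENNReal.ofReal (t / 2) < g z}.indicator g) x}) *
            (ENNReal.ofReal 2 * ENNReal.ofReal (t ^ (p - 1 - 1))) := by rw [hfac]; ring
      _ ≤ (ENNReal.ofReal C * (μ.withDensity g) {x | t < 2 * (g x).toReal}) *
            (ENNReal.ofReal 2 * ENNReal.ofReal (t ^ (p - 1 - 1))) := by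
          rw [hset2]
          exact mul_le_mul' hweak le_rfl
      _ = _ := by rw [ENNReal.ofReal_mul zero_le_two]; ring
  have hL : ∫⁻ x, dyadicMaximal μ R g x ^ p ∂μ =
      ∫⁻ x, ENNReal.ofReal ((dyadicMaximal μ R g x).toReal ^ p) ∂μ := by
    refine lintegral_congr fun x => ?_
    rw [← ENNReal.ofReal_rpow_of_nonneg toReal_nonneg hp0.le, ENNReal.ofReal_toReal (hM x)]
  have hR' : ∫⁻ x, ENNReal.ofReal ((2 * (g x).toReal) ^ (p - 1)) ∂(μ.withDensity g) =
      ENNReal.ofReal (2 ^ (p - 1)) * ∫⁻ x, g x ^ p ∂μ := by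
    rw [lintegral_withDensity_eq_lintegral_mul _ hg
      ((hg.ennreal_toReal.const_mul 2).pow_const (p - 1)).ennreal_ofReal,
      ← lintegral_const_mul _ (hg.pow_const p)]
    refine lintegral_congr fun x => ?_
    rw [Pi.mul_apply, Real.mul_rpow zero_le_two toReal_nonneg,
      ENNReal.ofReal_mul (by positivity),
      ← ENNReal.ofReal_rpow_of_nonneg toReal_nonneg hp1.le, ENNReal.ofReal_toReal (hgf x)]
    have : g x ^ p = g x * g x ^ (p - 1) := by
      conv_lhs => rw [show p = 1 + (p - 1) by ring,
        ENNReal.rpow_add_of_nonneg _ _ zero_le_one hp1.le, ENNReal.rpow_one]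
    rw [this]; ring
  have hcake := lintegral_rpow_eq_lintegral_meas_lt_mul (μ.withDensity g)
    (f := fun x => 2 * (g x).toReal) (ae_of_all _ fun x => by positivity)
    (hg.ennreal_toReal.const_mul 2).aemeasurable hp1
  rw [hR'] at hcake
  rw [hL, lintegral_rpow_eq_lintegral_meas_lt_mul μ (ae_of_all _ fun x => toReal_nonneg)
    (measurable_dyadicMaximal μ R hg).ennreal_toReal.aemeasurable hp0]
  have hstep : ∫⁻ t in Set.Ioi (0 : ℝ), μ {x | t < (dyadicMaximal μ R g x).toReal} *
        ENNReal.ofReal (t ^ (p - 1)) ≤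
      ENNReal.ofReal (2 * C) * ∫⁻ t in Set.Ioi (0 : ℝ),
        (μ.withDensity g) {x | t < 2 * (g x).toReal} * ENNReal.ofReal (t ^ (p - 1 - 1)) := by
    rw [← lintegral_const_mul' _ _ ENNReal.ofReal_ne_top]
    exact setLIntegral_mono' measurableSet_Ioi fun t ht => hlevel t ht
  set I := ∫⁻ t in Set.Ioi (0 : ℝ),
        (μ.withDensity g) {x | t < 2 * (g x).toReal} * ENNReal.ofReal (t ^ (p - 1 - 1)) with hI
  have hIeq : I = ENNReal.ofReal (p - 1)⁻¹ * (ENNReal.ofReal (2 ^ (p - 1)) * ∫⁻ x, g x ^ p ∂μ) := by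
    rw [hcake, ← mul_assoc, ← ENNReal.ofReal_mul (by positivity), inv_mul_cancel₀ hp1.ne',
      ENNReal.ofReal_one, one_mul]
  refine (mul_le_mul_right hstep _).trans_eq ?_
  rw [hIeq, ← mul_assoc, ← mul_assoc, ← mul_assoc, ← ENNReal.ofReal_mul hp0.le,
    ← ENNReal.ofReal_mul (by positivity), ← ENNReal.ofReal_mul (by positivity)]
  congr 2
  ring

end MaximalFunction

section FractionalKernel

open Metric ENNReal Module

variable {E : Type*} [NormedAddCommGroup E] [NormedSpace ℝ E] [FiniteDimensional ℝ E]
  [MeasurableSpace E] [BorelSpace E] [Nontrivial E] (μ : Measure E) [μ.IsAddHaarMeasure]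

theorem integrable_min_norm_rpow_div {θ r : ℝ} (hθ0 : 0 < θ) (hθ1 : θ < 1) (hr : 0 < r) :
    Integrable (fun z : E => min ‖z‖ 1 ^ r / ‖z‖ ^ ((finrank ℝ E : ℝ) + θ * r)) μ := by
  have hd : 1 ≤ finrank ℝ E := finrank_pos
  rw [integrable_fun_norm_addHaar μ
    (f := fun ρ : ℝ => min ρ 1 ^ r / ρ ^ ((finrank ℝ E : ℝ) + θ * r))]
  have hpow : ∀ ρ : ℝ, 0 < ρ → ∀ m : ℝ, ρ ^ (finrank ℝ E - 1) •
      (m / ρ ^ ((finrank ℝ E : ℝ) + θ * r)) = m * ρ ^ (-1 - θ * r) := by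
    intro ρ hρ m
    rw [smul_eq_mul, ← Real.rpow_natCast, Nat.cast_sub hd, div_eq_mul_inv, ← Real.rpow_neg hρ.le,
      mul_left_comm, ← Real.rpow_add hρ]
    congr 2
    push_cast
    ring
  rw [← Set.Ioc_union_Ioi_eq_Ioi (zero_le_one (α := ℝ))]
  refine IntegrableOn.union ?_ ?_
  · have h : IntegrableOn (fun ρ : ℝ => ρ ^ (r - 1 - θ * r)) (Set.Ioc 0 1) := by
      rw [← intervalIntegrable_iff_integrableOn_Ioc_of_le zero_le_one]
      exact intervalIntegral.intervalIntegrable_rpow' (by nlinarith)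
    refine h.congr_fun (fun ρ hρ => ?_) measurableSet_Ioc
    simp only
    rw [hpow ρ hρ.1, min_eq_left hρ.2, ← Real.rpow_add hρ.1]
    congr 1
    ring
  · have h : IntegrableOn (fun ρ : ℝ => ρ ^ (-1 - θ * r)) (Set.Ioi 1) :=
      integrableOn_Ioi_rpow_of_lt (by nlinarith [mul_pos hθ0 hr]) zero_lt_one
    refine h.congr_fun (fun ρ hρ => ?_) measurableSet_Ioi
    simp only
    rw [hpow ρ (zero_lt_one.trans hρ), min_eq_right (le_of_lt hρ), Real.one_rpow, one_mul]

theorem exists_lintegral_min_rpow_div_le {θ r : ℝ} (hθ0 : 0 < θ) (hθ1 : θ < 1) (hr : 0 < r) :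
    ∃ J : ℝ, 0 ≤ J ∧ ∀ a b : ℝ, 0 < a → 0 < b → ∀ x : E,
      ∫⁻ y, ENNReal.ofReal
          (min (‖x - y‖ * a) b ^ r / ‖x - y‖ ^ ((finrank ℝ E : ℝ) + θ * r)) ∂μ ≤
        ENNReal.ofReal (J * (a ^ (θ * r) * b ^ ((1 - θ) * r))) := by
  set κ : ℝ := (finrank ℝ E : ℝ) + θ * r with hκ
  set f : E → ℝ := fun z => min ‖z‖ 1 ^ r / ‖z‖ ^ κ with hf
  have hf0 : ∀ z, 0 ≤ f z := fun z => by positivity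
  have hfi : Integrable f μ := integrable_min_norm_rpow_div μ hθ0 hθ1 hr
  refine ⟨∫ z, f z ∂μ, integral_nonneg hf0, fun a b ha hb x => ?_⟩
  have hc : 0 < a / b := by positivity
  have hscale : ∀ y : E, min (‖y‖ * a) b ^ r / ‖y‖ ^ κ =
      b ^ r * (a / b) ^ κ * f ((a / b) • y) := by
    intro y
    simp only [hf]
    rw [norm_smul, Real.norm_of_nonneg hc.le, Real.mul_rpow hc.le (norm_nonneg y)]
    have h1 : min (‖y‖ * a) b = b * min (a / b * ‖y‖) 1 := by
      rw [mul_min_of_nonneg _ _ hb.le]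
      congr 1
      · field_simp
      · ring
    rw [h1, Real.mul_rpow hb.le (by positivity)]
    have h2 : (a / b) ^ κ ≠ 0 := (Real.rpow_pos_of_pos hc κ).ne'
    by_cases h3 : ‖y‖ ^ κ = 0
    · simp [h3]
    · field_simp
  have hmeas : Measurable (fun z : E => ENNReal.ofReal (f z)) := by
    simp only [hf]; fun_prop
  have hK : 0 ≤ b ^ r * (a / b) ^ κ := by positivity
  calc ∫⁻ y, ENNReal.ofReal (min (‖x - y‖ * a) b ^ r / ‖x - y‖ ^ κ) ∂μ
      = ∫⁻ y, ENNReal.ofReal (min (‖y‖ * a) b ^ r / ‖y‖ ^ κ) ∂μ :=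
        lintegral_sub_left_eq_self (μ := μ)
          (fun y => ENNReal.ofReal (min (‖y‖ * a) b ^ r / ‖y‖ ^ κ)) x
    _ = ENNReal.ofReal (b ^ r * (a / b) ^ κ) *
          ∫⁻ y, ENNReal.ofReal (f ((a / b) • y)) ∂μ := by
        rw [← lintegral_const_mul' _ _ ENNReal.ofReal_ne_top]
        refine lintegral_congr fun y => ?_
        rw [hscale, ENNReal.ofReal_mul hK]
    _ = ENNReal.ofReal (b ^ r * (a / b) ^ κ) *
          (ENNReal.ofReal |((a / b) ^ finrank ℝ E)⁻¹| * ∫⁻ z, ENNReal.ofReal (f z) ∂μ) := by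
        rw [← smul_eq_mul (ENNReal.ofReal |((a / b) ^ finrank ℝ E)⁻¹|), ← lintegral_smul_measure,
          ← Measure.map_addHaar_smul μ hc.ne', lintegral_map hmeas (measurable_const_smul _)]
    _ ≤ ENNReal.ofReal ((∫ z, f z ∂μ) * (a ^ (θ * r) * b ^ ((1 - θ) * r))) := by
        refine le_of_eq ?_
        rw [← ofReal_integral_eq_lintegral_ofReal hfi (ae_of_all _ hf0),
          ← ENNReal.ofReal_mul (abs_nonneg _), ← ENNReal.ofReal_mul hK]
        congr 1
        rw [abs_of_nonneg (by positivity), ← Real.rpow_natCast, ← Real.rpow_neg hc.le]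
        have h : b ^ r * (a / b) ^ κ * (a / b) ^ (-(finrank ℝ E : ℝ)) =
            a ^ (θ * r) * b ^ ((1 - θ) * r) := by
          rw [mul_assoc, ← Real.rpow_add hc, show κ + -(finrank ℝ E : ℝ) = θ * r by rw [hκ]; ring,
            Real.div_rpow ha.le hb.le, show (1 - θ) * r = r - θ * r by ring, Real.rpow_sub hb]
          field_simp
        linear_combination (∫ z, f z ∂μ) * h

end FractionalKernel

section GagliardoSeminorm

open Metric ENNReal Module

variable {E : Type*} [NormedAddCommGroup E] [NormedSpace ℝ E] [FiniteDimensional ℝ E]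
  [MeasurableSpace E] [BorelSpace E] [Nontrivial E] (μ : Measure E) [μ.IsAddHaarMeasure]
  {F : Type*} [NormedAddCommGroup F]

theorem le_two_mul_max_min {s A d ax ay bx b_y : ℝ} (hA : 0 ≤ A) (hd : 0 ≤ d)
    (h1 : s ≤ A * (d * (ax + ay))) (h2 : s ≤ A * (bx + b_y))
    (hab : ax ≤ ay ∧ bx ≤ b_y ∨ ay ≤ ax ∧ b_y ≤ bx) :
    s ≤ A * (2 * max (min (d * ax) bx) (min (d * ay) b_y)) := by
  rcases hab with ⟨ha, hb⟩ | ⟨ha, hb⟩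
  · refine le_trans ?_ (mul_le_mul_of_nonneg_left
      (mul_le_mul_of_nonneg_left (le_max_right _ _) zero_le_two) hA)
    rw [mul_min_of_nonneg _ _ zero_le_two, mul_min_of_nonneg _ _ hA]
    refine le_min (h1.trans ?_) (h2.trans ?_)
    · nlinarith [mul_le_mul_of_nonneg_left (mul_le_mul_of_nonneg_left ha hd) hA]
    · nlinarith [mul_le_mul_of_nonneg_left hb hA]
  · refine le_trans ?_ (mul_le_mul_of_nonneg_left
      (mul_le_mul_of_nonneg_left (le_max_left _ _) zero_le_two) hA)
    rw [mul_min_of_nonneg _ _ zero_le_two, mul_min_of_nonneg _ _ hA]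
    refine le_min (h1.trans ?_) (h2.trans ?_)
    · nlinarith [mul_le_mul_of_nonneg_left (mul_le_mul_of_nonneg_left ha hd) hA]
    · nlinarith [mul_le_mul_of_nonneg_left hb hA]

/-- A function with a Hajłasz gradient `K • G` in `L^γ` and values bounded by `K • H` with `H`
in `L^δ` has finite Gagliardo seminorm for all exponents `θ, r` satisfying the
Gagliardo–Nirenberg relation. -/
theorem exists_lintegral_gagliardo_le {θ r γ δ : ℝ} (hθ0 : 0 < θ) (hθ1 : θ < 1) (hr : 0 < r)
    (hγ : 0 < γ) (hδ : 0 < δ) (hexp : θ * r / γ + (1 - θ) * r / δ ≤ 1) :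
    ∃ C : ℝ, 0 ≤ C ∧ ∀ (Ω : Set E) (w : E → F) (G H : E → ℝ) (K : ℝ), MeasurableSet Ω →
      Measurable G → Measurable H → (∀ x, 0 ≤ G x) → (∀ x, 0 ≤ H x) → 0 ≤ K →
      (∀ x ∈ Ω, ∀ y ∈ Ω, ‖w x - w y‖ ≤ K * (‖x - y‖ * (G x + G y))) →
      (∀ x ∈ Ω, ∀ y ∈ Ω, ‖w x - w y‖ ≤ K * (H x + H y)) →
      ∫⁻ x in Ω, ∫⁻ y in Ω, ENNReal.ofReal
          (‖w x - w y‖ ^ r / ‖x - y‖ ^ ((finrank ℝ E : ℝ) + θ * r)) ∂μ ∂μ ≤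
        ENNReal.ofReal (C * K ^ r) *
          ∫⁻ x in Ω, ENNReal.ofReal (1 + G x ^ γ + H x ^ δ) ∂μ := by
  obtain ⟨J, hJ0, hJ⟩ := exists_lintegral_min_rpow_div_le μ hθ0 hθ1 hr
  refine ⟨2 ^ r * (2 * J), by positivity, fun Ω w G H K hΩ hGm hHm hG hH hK hw1 hw2 => ?_⟩
  set κ : ℝ := (finrank ℝ E : ℝ) + θ * r with hκ
  set Φ : E → ℝ := fun x => 1 + G x ^ γ + H x ^ δ with hΦ
  have hGp : ∀ x, 0 ≤ G x ^ γ := fun x => Real.rpow_nonneg (hG x) _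
  have hHp : ∀ x, 0 ≤ H x ^ δ := fun x => Real.rpow_nonneg (hH x) _
  have hΦ1 : ∀ x, 1 ≤ Φ x := fun x => by simp only [hΦ]; linarith [hGp x, hHp x]
  have hΦ0 : ∀ x, 0 < Φ x := fun x => zero_lt_one.trans_le (hΦ1 x)
  have hΦm : Measurable Φ := by simp only [hΦ]; fun_prop
  have hGle : ∀ x, G x ≤ Φ x ^ γ⁻¹ := fun x => by
    rw [Real.le_rpow_inv_iff_of_pos (hG x) (hΦ0 x).le hγ]
    simp only [hΦ]; linarith [hHp x]
  have hHle : ∀ x, H x ≤ Φ x ^ δ⁻¹ := fun x => by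
    rw [Real.le_rpow_inv_iff_of_pos (hH x) (hΦ0 x).le hδ]
    simp only [hΦ]; linarith [hGp x]
  set k : E → E → ℝ := fun x y =>
    min (‖x - y‖ * Φ x ^ γ⁻¹) (Φ x ^ δ⁻¹) ^ r / ‖x - y‖ ^ κ with hk
  have hm0 : ∀ x y, 0 ≤ min (‖x - y‖ * Φ x ^ γ⁻¹) (Φ x ^ δ⁻¹) := fun x y =>
    le_min (mul_nonneg (norm_nonneg _) (Real.rpow_nonneg (hΦ0 x).le _))
      (Real.rpow_nonneg (hΦ0 x).le _)
  have hk0 : ∀ x y, 0 ≤ k x y := fun x y =>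
    div_nonneg (Real.rpow_nonneg (hm0 x y) _) (Real.rpow_nonneg (norm_nonneg _) _)
  have hkm : Measurable (fun p : E × E => ENNReal.ofReal (k p.1 p.2)) := by
    simp only [hk]; fun_prop
  have hkm1 : ∀ x, Measurable (fun y => ENNReal.ofReal (k x y)) := fun x => by
    simp only [hk]; fun_prop
  have hkm2 : Measurable (fun x => ∫⁻ y in Ω, ENNReal.ofReal (k x y) ∂μ) :=
    hkm.lintegral_prod_right'
  have hA : 0 ≤ 2 ^ r * K ^ r := by positivity
  have hpt : ∀ x ∈ Ω, ∀ y ∈ Ω, ‖w x - w y‖ ^ r / ‖x - y‖ ^ κ ≤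
      2 ^ r * K ^ r * (k x y + k y x) := by
    intro x hx y hy
    have h1 : ‖w x - w y‖ ≤ K * (2 * max (min (‖x - y‖ * Φ x ^ γ⁻¹) (Φ x ^ δ⁻¹))
        (min (‖x - y‖ * Φ y ^ γ⁻¹) (Φ y ^ δ⁻¹))) := by
      refine le_two_mul_max_min hK (norm_nonneg _) ?_ ?_ ?_
      · refine (hw1 x hx y hy).trans ?_
        gcongr
        exacts [hGle x, hGle y]
      · refine (hw2 x hx y hy).trans ?_
        gcongr
        exacts [hHle x, hHle y]
      · rcases le_total (Φ x) (Φ y) with h | h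
        · exact .inl ⟨Real.rpow_le_rpow (hΦ0 x).le h (by positivity),
            Real.rpow_le_rpow (hΦ0 x).le h (by positivity)⟩
        · exact .inr ⟨Real.rpow_le_rpow (hΦ0 y).le h (by positivity),
            Real.rpow_le_rpow (hΦ0 y).le h (by positivity)⟩
    have hyx : min (‖x - y‖ * Φ y ^ γ⁻¹) (Φ y ^ δ⁻¹) =
        min (‖y - x‖ * Φ y ^ γ⁻¹) (Φ y ^ δ⁻¹) := by rw [norm_sub_rev]
    have hmax : max (min (‖x - y‖ * Φ x ^ γ⁻¹) (Φ x ^ δ⁻¹))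
        (min (‖x - y‖ * Φ y ^ γ⁻¹) (Φ y ^ δ⁻¹)) ^ r ≤
        min (‖x - y‖ * Φ x ^ γ⁻¹) (Φ x ^ δ⁻¹) ^ r +
          min (‖y - x‖ * Φ y ^ γ⁻¹) (Φ y ^ δ⁻¹) ^ r := by
      rw [hyx]
      rcases max_choice (min (‖x - y‖ * Φ x ^ γ⁻¹) (Φ x ^ δ⁻¹))
        (min (‖y - x‖ * Φ y ^ γ⁻¹) (Φ y ^ δ⁻¹)) with h | h <;> rw [h]
      · linarith [Real.rpow_nonneg (hm0 y x) r]
      · linarith [Real.rpow_nonneg (hm0 x y) r]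
    have h2 : ‖w x - w y‖ ^ r ≤ 2 ^ r * K ^ r *
        (min (‖x - y‖ * Φ x ^ γ⁻¹) (Φ x ^ δ⁻¹) ^ r +
          min (‖y - x‖ * Φ y ^ γ⁻¹) (Φ y ^ δ⁻¹) ^ r) := by
      refine (Real.rpow_le_rpow (norm_nonneg _) h1 hr.le).trans ?_
      have hmx : 0 ≤ max (min (‖x - y‖ * Φ x ^ γ⁻¹) (Φ x ^ δ⁻¹))
        (min (‖x - y‖ * Φ y ^ γ⁻¹) (Φ y ^ δ⁻¹)) := le_max_of_le_left (hm0 x y)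
      rw [Real.mul_rpow hK (by positivity), Real.mul_rpow zero_le_two hmx, ← mul_assoc,
        mul_comm (K ^ r)]
      exact mul_le_mul_of_nonneg_left hmax hA
    calc ‖w x - w y‖ ^ r / ‖x - y‖ ^ κ
        ≤ (2 ^ r * K ^ r * (min (‖x - y‖ * Φ x ^ γ⁻¹) (Φ x ^ δ⁻¹) ^ r +
          min (‖y - x‖ * Φ y ^ γ⁻¹) (Φ y ^ δ⁻¹) ^ r)) / ‖x - y‖ ^ κ := by gcongr
      _ = _ := by simp only [hk]; rw [norm_sub_rev y x]; ring
  have h_int : ∀ x, ∫⁻ y in Ω, ENNReal.ofReal (k x y) ∂μ ≤ ENNReal.ofReal (J * Φ x) := by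
    intro x
    refine (setLIntegral_le_lintegral _ _).trans ((hJ (Φ x ^ γ⁻¹) (Φ x ^ δ⁻¹)
      (Real.rpow_pos_of_pos (hΦ0 x) _) (Real.rpow_pos_of_pos (hΦ0 x) _) x).trans ?_)
    refine ENNReal.ofReal_le_ofReal (mul_le_mul_of_nonneg_left ?_ hJ0)
    rw [← Real.rpow_mul (hΦ0 x).le, ← Real.rpow_mul (hΦ0 x).le, ← Real.rpow_add (hΦ0 x)]
    calc Φ x ^ (γ⁻¹ * (θ * r) + δ⁻¹ * ((1 - θ) * r)) ≤ Φ x ^ (1 : ℝ) := by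
          refine Real.rpow_le_rpow_of_exponent_le (hΦ1 x) (le_trans (le_of_eq ?_) hexp)
          ring
      _ = Φ x := Real.rpow_one _
  calc ∫⁻ x in Ω, ∫⁻ y in Ω, ENNReal.ofReal (‖w x - w y‖ ^ r / ‖x - y‖ ^ κ) ∂μ ∂μ
      ≤ ∫⁻ x in Ω, ∫⁻ y in Ω, ENNReal.ofReal (2 ^ r * K ^ r) *
          (ENNReal.ofReal (k x y) + ENNReal.ofReal (k y x)) ∂μ ∂μ := by
        refine setLIntegral_mono' hΩ fun x hx => setLIntegral_mono' hΩ fun y hy => ?_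
        rw [← ENNReal.ofReal_add (hk0 x y) (hk0 y x), ← ENNReal.ofReal_mul hA]
        exact ENNReal.ofReal_le_ofReal (hpt x hx y hy)
    _ = ENNReal.ofReal (2 ^ r * K ^ r) * (∫⁻ x in Ω, ∫⁻ y in Ω, ENNReal.ofReal (k x y) ∂μ ∂μ +
          ∫⁻ x in Ω, ∫⁻ y in Ω, ENNReal.ofReal (k y x) ∂μ ∂μ) := by
        rw [← lintegral_add_left hkm2,
          ← lintegral_const_mul' _ _ ENNReal.ofReal_ne_top]
        refine lintegral_congr fun x => ?_
        rw [lintegral_const_mul' _ _ ENNReal.ofReal_ne_top,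
          lintegral_add_left (hkm1 x)]
    _ = ENNReal.ofReal (2 ^ r * K ^ r) *
          (2 * ∫⁻ x in Ω, ∫⁻ y in Ω, ENNReal.ofReal (k x y) ∂μ ∂μ) := by
        rw [lintegral_lintegral_swap (f := fun x y => ENNReal.ofReal (k y x))
          (hkm.comp measurable_swap).aemeasurable, two_mul]
    _ ≤ ENNReal.ofReal (2 ^ r * K ^ r) * (2 * ∫⁻ x in Ω, ENNReal.ofReal (J * Φ x) ∂μ) := by
        gcongr with x
        exact h_int x
    _ = _ := by
        simp_rw [ENNReal.ofReal_mul hJ0]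
        rw [lintegral_const_mul' _ _ ENNReal.ofReal_ne_top, ← mul_assoc, ← mul_assoc,
          show (2 : ℝ≥0∞) = ENNReal.ofReal 2 by simp, ← ENNReal.ofReal_mul hA,
          ← ENNReal.ofReal_mul (by positivity)]
        congr 2
        ring

end GagliardoSeminorm

section HajlaszEstimate

open Metric ENNReal Module

variable {E : Type*} [NormedAddCommGroup E] [NormedSpace ℝ E]
  {F : Type*} [NormedAddCommGroup F] [NormedSpace ℝ F]

theorem enorm_sub_le_lintegral_segment {Ω : Set E} (hΩ : IsOpen Ω) {w : E → F}
    (hw : ContDiffOn ℝ 1 w Ω) {g : E → ℝ≥0∞} (hg : ∀ z ∈ Ω, ‖fderiv ℝ w z‖ₑ ≤ g z) {x b : E}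
    (hxb : segment ℝ x b ⊆ Ω) :
    ‖w x - w b‖ₑ ≤ ‖b - x‖ₑ * ∫⁻ τ in Set.Ioo (0 : ℝ) 1, g (x + τ • (b - x)) := by
  have hmem : ∀ τ ∈ Set.Icc (0 : ℝ) 1, x + τ • (b - x) ∈ Ω := fun τ hτ =>
    hxb (by rw [segment_eq_image']; exact ⟨τ, hτ, rfl⟩)
  have hline : ContDiff ℝ 1 (fun τ : ℝ => x + τ • (b - x)) := by fun_prop
  have hcomp : ContDiffOn ℝ 1 (fun τ : ℝ => w (x + τ • (b - x))) (Set.Icc 0 1) :=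
    hw.comp hline.contDiffOn hmem
  have h := enorm_sub_le_lintegral_deriv_of_contDiffOn_Icc hcomp zero_le_one
  simp only [one_smul, add_sub_cancel, zero_smul, add_zero] at h
  rw [← edist_eq_enorm_sub, edist_comm, edist_eq_enorm_sub,
    ← lintegral_const_mul' _ _ enorm_ne_top, restrict_Ioo_eq_restrict_Icc]
  refine h.trans (setLIntegral_mono' measurableSet_Icc fun τ hτ => ?_)
  have hd : HasDerivAt (fun τ : ℝ => w (x + τ • (b - x)))
      (fderiv ℝ w (x + τ • (b - x)) (b - x)) τ := by
    have h1 : HasFDerivAt w (fderiv ℝ w (x + τ • (b - x))) (x + τ • (b - x)) :=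
      ((hw.contDiffAt (hΩ.mem_nhds (hmem τ hτ))).differentiableAt (by simp)).hasFDerivAt
    have h2 : HasDerivAt (fun τ : ℝ => x + τ • (b - x)) (b - x) τ := by
      simpa using ((hasDerivAt_id τ).smul_const (b - x)).const_add x
    exact h1.comp_hasDerivAt τ h2
  rw [hd.deriv, mul_comm]
  exact (ContinuousLinearMap.le_opENorm _ _).trans (by gcongr; exact hg _ (hmem τ hτ))

variable [FiniteDimensional ℝ E] [MeasurableSpace E] [BorelSpace E]
  (μ : Measure E) [μ.IsAddHaarMeasure]

theorem setLIntegral_closedBall_homothety {g : E → ℝ≥0∞} (hg : Measurable g) (x : E)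
    {τ ρ : ℝ} (hτ : 0 < τ) :
    ∫⁻ b in closedBall x ρ, g (x + τ • (b - x)) ∂μ =
      ENNReal.ofReal (τ ^ finrank ℝ E)⁻¹ * ∫⁻ z in closedBall x (τ * ρ), g z ∂μ := by
  set h : E → ℝ≥0∞ := fun v => (closedBall x (τ * ρ)).indicator g (x + v) with hh
  have hhm : Measurable h :=
    (hg.indicator measurableSet_closedBall).comp (measurable_const_add x)
  calc ∫⁻ b in closedBall x ρ, g (x + τ • (b - x)) ∂μ
      = ∫⁻ b, h (τ • (b - x)) ∂μ := by
        rw [← lintegral_indicator measurableSet_closedBall]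
        refine lintegral_congr fun b => ?_
        have hiff : x + τ • (b - x) ∈ closedBall x (τ * ρ) ↔ b ∈ closedBall x ρ := by
          simp only [mem_closedBall, dist_eq_norm, add_sub_cancel_left, norm_smul,
            Real.norm_of_nonneg hτ.le, mul_le_mul_iff_right₀ hτ]
        by_cases hb : b ∈ closedBall x ρ
        · simp only [hh, Set.indicator_of_mem hb, Set.indicator_of_mem (hiff.2 hb)]
        · simp only [hh, Set.indicator_of_notMem hb, Set.indicator_of_notMem (mt hiff.1 hb)]
    _ = ∫⁻ b, h (τ • b) ∂μ := lintegral_sub_right_eq_self (fun b => h (τ • b)) x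
    _ = ENNReal.ofReal |(τ ^ finrank ℝ E)⁻¹| * ∫⁻ v, h v ∂μ := by
        rw [← smul_eq_mul (ENNReal.ofReal _), ← lintegral_smul_measure,
          ← Measure.map_addHaar_smul μ hτ.ne', lintegral_map hhm (measurable_const_smul _)]
    _ = _ := by
        rw [abs_of_nonneg (by positivity), ← lintegral_indicator measurableSet_closedBall]
        congr 1
        exact lintegral_add_left_eq_self ((closedBall x (τ * ρ)).indicator g) x

theorem lintegral_closedBall_enorm_sub_le {Ω : Set E} (hΩ : IsOpen Ω) {w : E → F}
    (hw : ContDiffOn ℝ 1 w Ω) {g : E → ℝ≥0∞} (hgm : Measurable g)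
    (hg : ∀ z ∈ Ω, ‖fderiv ℝ w z‖ₑ ≤ g z) {x c : E} {d Λ R : ℝ} (hd : 0 < d) (hΛ : 0 < Λ)
    (hball : closedBall c d ⊆ closedBall x (Λ * d)) (hR : Λ * d ≤ R)
    (hseg : ∀ b ∈ closedBall c d, segment ℝ x b ⊆ Ω) :
    ∫⁻ b in closedBall c d, ‖w x - w b‖ₑ ∂μ ≤
      μ (closedBall c d) * (ENNReal.ofReal (Λ * (2 * Λ) ^ finrank ℝ E) *
        (ENNReal.ofReal d * dyadicMaximal μ R g x)) := by
  have hΛd : 0 < Λ * d := by positivity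
  have hm : Measurable (fun p : E × ℝ => g (x + p.2 • (p.1 - x))) := by fun_prop
  have hτ : ∀ τ ∈ Set.Ioo (0 : ℝ) 1, ∫⁻ b in closedBall c d, g (x + τ • (b - x)) ∂μ ≤
      ENNReal.ofReal (2 ^ finrank ℝ E) * μ (closedBall (0 : E) (Λ * d)) *
        dyadicMaximal μ R g x := by
    intro τ hτ
    have hle : τ * (Λ * d) ≤ R := (mul_le_of_le_one_left hΛd.le hτ.2.le).trans hR
    calc ∫⁻ b in closedBall c d, g (x + τ • (b - x)) ∂μ
        ≤ ∫⁻ b in closedBall x (Λ * d), g (x + τ • (b - x)) ∂μ := lintegral_mono_set hball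
      _ = ENNReal.ofReal (τ ^ finrank ℝ E)⁻¹ * ∫⁻ z in closedBall x (τ * (Λ * d)), g z ∂μ :=
          setLIntegral_closedBall_homothety μ hgm x hτ.1
      _ ≤ ENNReal.ofReal (τ ^ finrank ℝ E)⁻¹ * (ENNReal.ofReal (2 ^ finrank ℝ E) *
            μ (closedBall (0 : E) (τ * (Λ * d))) * dyadicMaximal μ R g x) := by
          gcongr
          exact lintegral_closedBall_le_dyadicMaximal μ g x (mul_pos hτ.1 hΛd) hle
      _ = (ENNReal.ofReal (τ ^ finrank ℝ E)⁻¹ * ENNReal.ofReal (τ ^ finrank ℝ E)) *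
            (ENNReal.ofReal (2 ^ finrank ℝ E) * μ (closedBall (0 : E) (Λ * d)) *
              dyadicMaximal μ R g x) := by
          rw [Measure.addHaar_closedBall_mul μ 0 hτ.1.le hΛd.le]; ring
      _ = _ := by
          have := pow_pos hτ.1 (finrank ℝ E)
          rw [← ENNReal.ofReal_mul (by positivity), inv_mul_cancel₀ this.ne',
            ENNReal.ofReal_one, one_mul]
  calc ∫⁻ b in closedBall c d, ‖w x - w b‖ₑ ∂μ
      ≤ ∫⁻ b in closedBall c d, (ENNReal.ofReal (Λ * d) *
          ∫⁻ τ in Set.Ioo (0 : ℝ) 1, g (x + τ • (b - x))) ∂μ := by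
        refine setLIntegral_mono' measurableSet_closedBall fun b hb => ?_
        refine (enorm_sub_le_lintegral_segment hΩ hw hg (hseg b hb)).trans ?_
        gcongr
        rw [← ofReal_norm, ← dist_eq_norm]
        exact ENNReal.ofReal_le_ofReal (hball hb)
    _ = ENNReal.ofReal (Λ * d) * ∫⁻ τ in Set.Ioo (0 : ℝ) 1,
          ∫⁻ b in closedBall c d, g (x + τ • (b - x)) ∂μ := by
        rw [lintegral_const_mul' _ _ ENNReal.ofReal_ne_top,
          lintegral_lintegral_swap hm.aemeasurable]
    _ ≤ ENNReal.ofReal (Λ * d) * ∫⁻ _ in Set.Ioo (0 : ℝ) 1,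
          ENNReal.ofReal (2 ^ finrank ℝ E) * μ (closedBall (0 : E) (Λ * d)) *
            dyadicMaximal μ R g x := by
        exact mul_le_mul' le_rfl (setLIntegral_mono' measurableSet_Ioo hτ)
    _ = _ := by
        rw [setLIntegral_const, Real.volume_Ioo, sub_zero, ENNReal.ofReal_one, mul_one,
          Measure.addHaar_closedBall_mul μ 0 hΛ.le hd.le, Measure.addHaar_closedBall_center μ c,
          ENNReal.ofReal_mul hΛ.le, ENNReal.ofReal_mul hΛ.le, mul_pow,
          ENNReal.ofReal_mul (by positivity)]
        ring

/-- If `x` and `y` see a common ball of radius comparable to `dist x y`, then `w` satisfies the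
pointwise estimate of Hajłasz at `x, y` with the maximal function of its derivative. -/
theorem enorm_sub_le_dyadicMaximal {Ω : Set E} (hΩ : IsOpen Ω) {w : E → F}
    (hw : ContDiffOn ℝ 1 w Ω) {g : E → ℝ≥0∞} (hgm : Measurable g)
    (hg : ∀ z ∈ Ω, ‖fderiv ℝ w z‖ₑ ≤ g z) {x y c : E} {d Λ R : ℝ} (hd : 0 < d) (hΛ : 0 < Λ)
    (hx : closedBall c d ⊆ closedBall x (Λ * d)) (hy : closedBall c d ⊆ closedBall y (Λ * d))
    (hR : Λ * d ≤ R) (hsx : ∀ b ∈ closedBall c d, segment ℝ x b ⊆ Ω)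
    (hsy : ∀ b ∈ closedBall c d, segment ℝ y b ⊆ Ω) :
    ‖w x - w y‖ₑ ≤ ENNReal.ofReal (Λ * (2 * Λ) ^ finrank ℝ E) *
      (ENNReal.ofReal d * (dyadicMaximal μ R g x + dyadicMaximal μ R g y)) := by
  have h0 : μ (closedBall c d) ≠ 0 := (measure_closedBall_pos μ _ hd).ne'
  have h1 : μ (closedBall c d) ≠ ∞ := measure_closedBall_lt_top.ne
  have hsub : closedBall c d ⊆ Ω := fun b hb => hsx b hb (right_mem_segment ℝ x b)
  have hwc : ContinuousOn (fun b => ‖w x - w b‖ₑ) (closedBall c d) :=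
    (continuousOn_const.sub (hw.continuousOn.mono hsub)).enorm
  refine (ENNReal.mul_le_mul_iff_right h0 h1).1 ?_
  calc μ (closedBall c d) * ‖w x - w y‖ₑ = ∫⁻ _ in closedBall c d, ‖w x - w y‖ₑ ∂μ := by
        rw [setLIntegral_const, mul_comm]
    _ ≤ ∫⁻ b in closedBall c d, (‖w x - w b‖ₑ + ‖w y - w b‖ₑ) ∂μ := by
        refine lintegral_mono fun b => ?_
        simp only [← edist_eq_enorm_sub]
        exact edist_triangle_right _ _ _
    _ = ∫⁻ b in closedBall c d, ‖w x - w b‖ₑ ∂μ + ∫⁻ b in closedBall c d, ‖w y - w b‖ₑ ∂μ :=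
        lintegral_add_left' (hwc.aemeasurable measurableSet_closedBall) _
    _ ≤ _ := add_le_add
          (lintegral_closedBall_enorm_sub_le μ hΩ hw hgm hg hd hΛ hx hR hsx)
          (lintegral_closedBall_enorm_sub_le μ hΩ hw hgm hg hd hΛ hy hR hsy)
    _ = _ := by ring

end HajlaszEstimate

section InwardDirections

open Metric

variable {E : Type*} [NormedAddCommGroup E] [NormedSpace ℝ E]

/-- Near any point of the closure of a sublevel domain, moving in the directions of a fixed cone
does not leave the domain. -/
theorem exists_ball_inward_cone {f : E → ℝ} (hf : ContDiff ℝ 1 f) {Ω : Set E} (hΩo : IsOpen Ω)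
    (hΩ : Ω = {x | f x < 0}) (hfr : ∀ x ∈ frontier Ω, fderiv ℝ f x ≠ 0) {p : E}
    (hp : p ∈ closure Ω) :
    ∃ ρ > 0, ∃ v₀ : E, ‖v₀‖ ≤ 1 ∧ ∀ x ∈ Ω, x ∈ ball p ρ → ∀ v ∈ closedBall ((3 : ℝ) • v₀) 2,
      ∀ s : ℝ, 0 ≤ s → x + s • v ∈ ball p ρ → x + s • v ∈ Ω := by
  by_cases hpΩ : p ∈ Ω
  · obtain ⟨ρ, hρ, hsub⟩ := Metric.isOpen_iff.1 hΩo p hpΩ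
    exact ⟨ρ, hρ, 0, by simp, fun x _ _ v _ s _ h => hsub h⟩
  have hpf : fderiv ℝ f p ≠ 0 := hfr p ⟨hp, by rwa [hΩo.interior_eq]⟩
  set M := ‖fderiv ℝ f p‖ with hM
  have hM0 : 0 < M := norm_pos_iff.2 hpf
  obtain ⟨v₁, hv₁, hlt⟩ := (fderiv ℝ f p).exists_lt_apply_of_lt_opNorm
    (r := 5 / 6 * M) (by rw [← hM]; linarith)
  obtain ⟨v₀, hv₀, hlt0⟩ : ∃ v₀ : E, ‖v₀‖ ≤ 1 ∧ fderiv ℝ f p v₀ < -(5 / 6 * M) := by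
    rcases lt_abs.1 hlt with h | h
    · exact ⟨-v₁, by rw [norm_neg]; exact hv₁.le, by rw [map_neg]; linarith⟩
    · exact ⟨v₁, hv₁.le, by linarith⟩
  have hcont : ContinuousAt (fderiv ℝ f) p := (hf.continuous_fderiv (by simp)).continuousAt
  obtain ⟨ρ, hρ, hball⟩ := Metric.continuousAt_iff.1 hcont (M / 10) (by positivity)
  refine ⟨ρ, hρ, v₀, hv₀, fun x hx hxp v hv s hs hxs => ?_⟩
  obtain ⟨z, hz, hfz⟩ := domain_mvt (f := f) (f' := fderiv ℝ f) (s := ball p ρ)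
    (fun x _ => ((hf.differentiable (by simp)) x).hasFDerivAt.hasFDerivWithinAt)
    (convex_ball p ρ) hxp hxs
  have hzp : ‖fderiv ℝ f z - fderiv ℝ f p‖ ≤ M / 10 := by
    rw [← dist_eq_norm]
    exact (hball ((convex_ball p ρ).segment_subset hxp hxs hz)).le
  have hvn : ‖v - (3 : ℝ) • v₀‖ ≤ 2 := by rw [← dist_eq_norm]; exact hv
  have h3 : ‖(3 : ℝ) • v₀‖ ≤ 3 := by
    rw [norm_smul, Real.norm_of_nonneg (by norm_num)]; linarith
  have hv5 : ‖v‖ ≤ 5 := by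
    have := norm_add_le (v - (3 : ℝ) • v₀) ((3 : ℝ) • v₀)
    rw [sub_add_cancel] at this
    linarith
  have e1 : fderiv ℝ f z v = (fderiv ℝ f z - fderiv ℝ f p) v +
      (fderiv ℝ f p (v - (3 : ℝ) • v₀) + 3 * fderiv ℝ f p v₀) := by
    simp
  have e2 : (fderiv ℝ f z - fderiv ℝ f p) v ≤ M / 10 * 5 :=
    (le_abs_self _).trans ((ContinuousLinearMap.le_opNorm _ v).trans
      (mul_le_mul hzp hv5 (norm_nonneg _) (by positivity)))
  have e3 : fderiv ℝ f p (v - (3 : ℝ) • v₀) ≤ M * 2 :=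
    (le_abs_self _).trans ((ContinuousLinearMap.le_opNorm _ _).trans
      (mul_le_mul_of_nonneg_left hvn hM0.le))
  have hneg : fderiv ℝ f z v ≤ 0 := by rw [e1]; linarith
  rw [add_sub_cancel_left, map_smul, smul_eq_mul] at hfz
  rw [hΩ, Set.mem_ofPred_eq] at hx ⊢
  have := mul_nonpos_of_nonneg_of_nonpos hs hneg
  linarith

theorem exists_common_ball_of_sublevel [FiniteDimensional ℝ E] {f : E → ℝ} (hf : ContDiff ℝ 1 f)
    {Ω : Set E} (hΩo : IsOpen Ω) (hΩb : Bornology.IsBounded Ω) (hΩ : Ω = {x | f x < 0})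
    (hfr : ∀ x ∈ frontier Ω, fderiv ℝ f x ≠ 0) :
    ∃ ε > 0, ∀ x ∈ Ω, ∀ y ∈ Ω, x ≠ y → dist x y < ε → ∃ c : E,
      closedBall c (dist x y) ⊆ closedBall x (5 * dist x y) ∧
      closedBall c (dist x y) ⊆ closedBall y (5 * dist x y) ∧
      (∀ b ∈ closedBall c (dist x y), segment ℝ x b ⊆ Ω) ∧
      ∀ b ∈ closedBall c (dist x y), segment ℝ y b ⊆ Ω := by
  have hloc := fun p : closure Ω => exists_ball_inward_cone hf hΩo hΩ hfr p.2
  choose ρ hρ v₀ hv₀ hcone using hloc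
  obtain ⟨δ, hδ, hleb⟩ := lebesgue_number_lemma_of_metric
    (Metric.isCompact_of_isClosed_isBounded isClosed_closure hΩb.closure)
    (c := fun p : closure Ω => ball (p : E) (ρ p)) (fun _ => isOpen_ball)
    (fun p hp => Set.mem_iUnion.2 ⟨⟨p, hp⟩, mem_ball_self (hρ _)⟩)
  refine ⟨δ / 4, by positivity, fun x hx y hy hxy hd => ?_⟩
  obtain ⟨p, hp⟩ := hleb x (subset_closure hx)
  set d := dist x y with hd'
  have hd0 : 0 < d := dist_pos.2 hxy
  have hxy' : ‖x - y‖ = d := by rw [hd', dist_eq_norm]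
  have hdv : ‖(3 * d) • v₀ p‖ ≤ 3 * d := by
    rw [norm_smul, Real.norm_of_nonneg (by positivity)]
    exact mul_le_of_le_one_right (by positivity) (hv₀ p)
  have hbx : ∀ b ∈ closedBall (x + (3 * d) • v₀ p) d, ‖b - x‖ ≤ 4 * d := by
    intro b hb
    rw [mem_closedBall, dist_eq_norm] at hb
    have := norm_add_le (b - (x + (3 * d) • v₀ p)) ((3 * d) • v₀ p)
    rw [show b - (x + (3 * d) • v₀ p) + (3 * d) • v₀ p = b - x by abel] at this
    linarith
  have hby : ∀ b ∈ closedBall (x + (3 * d) • v₀ p) d, ‖b - y‖ ≤ 5 * d := by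
    intro b hb
    have := norm_add_le (b - x) (x - y)
    rw [sub_add_sub_cancel] at this
    linarith [hbx b hb]
  have key : ∀ a ∈ Ω, a ∈ ball x δ → ∀ b ∈ closedBall (x + (3 * d) • v₀ p) d,
      ‖x - a‖ ≤ d → segment ℝ a b ⊆ Ω := by
    intro a ha hax b hb hxa z hz
    have hbδ : b ∈ ball x δ := by
      rw [mem_ball, dist_eq_norm]; linarith [hbx b hb]
    have hzδ : z ∈ ball x δ := (convex_ball x δ).segment_subset hax hbδ hz
    rw [segment_eq_image'] at hz
    obtain ⟨τ, hτ, rfl⟩ := hz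
    have hrep : a + τ • (b - a) = a + (τ * d) • (d⁻¹ • (b - a)) := by
      rw [smul_smul, mul_assoc, mul_inv_cancel₀ hd0.ne', mul_one]
    simp only [hrep] at hzδ ⊢
    refine hcone p a ha (hp hax) _ ?_ _ (mul_nonneg hτ.1 hd0.le) (hp hzδ)
    rw [mem_closedBall, dist_eq_norm]
    have e : d⁻¹ • (b - a) - (3 : ℝ) • v₀ p =
        d⁻¹ • ((b - (x + (3 * d) • v₀ p)) + (x - a)) := by
      have : (3 : ℝ) • v₀ p = d⁻¹ • ((3 * d) • v₀ p) := by
        rw [smul_smul]; congr 1; field_simp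
      rw [this, ← smul_sub]; congr 1; abel
    rw [mem_closedBall, dist_eq_norm] at hb
    rw [e, norm_smul, Real.norm_of_nonneg (by positivity), inv_mul_le_iff₀ hd0]
    have := norm_add_le (b - (x + (3 * d) • v₀ p)) (x - a)
    linarith
  refine ⟨x + (3 * d) • v₀ p, fun b hb => ?_, fun b hb => ?_, fun b hb => ?_, fun b hb => ?_⟩
  · rw [mem_closedBall, dist_eq_norm]; linarith [hbx b hb]
  · rw [mem_closedBall, dist_eq_norm]; exact hby b hb
  · exact key x hx (mem_ball_self hδ) b hb (by simpa using hd0.le)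
  · refine key y hy ?_ b hb hxy'.le
    rw [mem_ball, dist_comm]; linarith

end InwardDirections

section FractionalInterpolation

open Metric ENNReal Module

variable {E : Type*} [NormedAddCommGroup E] [NormedSpace ℝ E] [FiniteDimensional ℝ E]
  [MeasurableSpace E] [BorelSpace E] [Nontrivial E] (μ : Measure E) [μ.IsAddHaarMeasure]
  {F : Type*} [NormedAddCommGroup F] [NormedSpace ℝ F] [CompleteSpace F]

/-- The fractional Gagliardo–Nirenberg inequality `W^{1,γ} ∩ L^δ ⊂ W^{θ,r}` on a smooth bounded
domain. -/
theorem exists_lintegral_gagliardo_le_of_sublevel {f : E → ℝ} (hf : ContDiff ℝ 1 f)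
    {Ω : Set E} (hΩo : IsOpen Ω) (hΩb : Bornology.IsBounded Ω) (hΩ : Ω = {x | f x < 0})
    (hfr : ∀ x ∈ frontier Ω, fderiv ℝ f x ≠ 0)
    {θ r γ δ : ℝ} (hθ0 : 0 < θ) (hθ1 : θ < 1) (hr : 0 < r)
    (hγ : 1 < γ) (hδ : 0 < δ) (hexp : θ * r / γ + (1 - θ) * r / δ ≤ 1) :
    ∃ C : ℝ, 0 ≤ C ∧ ∀ (w : E → F) (B K : ℝ), ContDiffOn ℝ 1 w Ω →
      (∀ x ∈ Ω, ‖fderiv ℝ w x‖ ≤ B) → 0 < K →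
      ∫⁻ x in Ω, ENNReal.ofReal (‖w x‖ ^ γ) ∂μ ≤ ENNReal.ofReal (K ^ γ) →
      ∫⁻ x in Ω, ENNReal.ofReal (‖fderiv ℝ w x‖ ^ γ) ∂μ ≤ ENNReal.ofReal (K ^ γ) →
      ∫⁻ x in Ω, ENNReal.ofReal (‖w x‖ ^ δ) ∂μ ≤ ENNReal.ofReal (K ^ δ) →
      ∫⁻ x in Ω, ∫⁻ y in Ω, ENNReal.ofReal
          (‖w x - w y‖ ^ r / ‖x - y‖ ^ ((finrank ℝ E : ℝ) + θ * r)) ∂μ ∂μ ≤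
        ENNReal.ofReal (C * K ^ r) := by
  have hγ0 : 0 < γ := by linarith
  obtain ⟨C₀, hC₀, hGag⟩ := exists_lintegral_gagliardo_le μ (F := F) hθ0 hθ1 hr hγ0 hδ hexp
  obtain ⟨ε, hε, hgeo⟩ := exists_common_ball_of_sublevel hf hΩo hΩb hΩ hfr
  set A : ℝ := 5 * (2 * 5) ^ finrank ℝ E with hA
  have hA0 : 0 < A := by positivity
  set R : ℝ := 5 * ε with hR
  have hR0 : 0 < R := by positivity
  set Cγ : ℝ := γ * (2 * 4 ^ finrank ℝ E) * (2 ^ (γ - 1) / (γ - 1)) with hCγ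
  have hCγ0 : 0 ≤ Cγ := by
    have : 0 < γ - 1 := by linarith
    positivity
  have hΩm : MeasurableSet Ω := hΩo.measurableSet
  have hΩfin : μ Ω ≠ ∞ := hΩb.measure_lt_top.ne
  set T : ℝ := 2 ^ (γ - 1) * (A ^ γ * Cγ + (ε⁻¹) ^ γ) with hT
  have hT0 : 0 ≤ T := by positivity
  refine ⟨C₀ * ((μ Ω).toReal + T + 1), by positivity, fun w B K hw hB hK hwγ hdγ hwδ => ?_⟩
  set g : E → ℝ≥0∞ := Ω.indicator fun z => ‖fderiv ℝ w z‖ₑ with hg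
  have hgm : Measurable g := (measurable_fderiv ℝ w).enorm.indicator hΩm
  have hgB : ∀ x, g x ≤ ENNReal.ofReal B := fun x => by
    by_cases hx : x ∈ Ω
    · rw [hg, Set.indicator_of_mem hx, ← ofReal_norm]
      exact ENNReal.ofReal_le_ofReal (hB x hx)
    · rw [hg, Set.indicator_of_notMem hx]; exact bot_le
  have hgle : ∀ z ∈ Ω, ‖fderiv ℝ w z‖ₑ ≤ g z := fun z hz => by
    rw [hg, Set.indicator_of_mem hz]
  set M := dyadicMaximal μ R g with hM
  have hMfin : ∀ x, M x ≠ ∞ := fun x =>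
    ((dyadicMaximal_le_of_le μ hR0 hgB x).trans_lt ENNReal.ofReal_lt_top).ne
  have hMm : Measurable M := measurable_dyadicMaximal μ R hgm
  have hMint : ∫⁻ x, M x ^ γ ∂μ ≤ ENNReal.ofReal (Cγ * K ^ γ) := by
    refine (lintegral_dyadicMaximal_rpow_le μ hR0 hγ hgm ENNReal.ofReal_ne_top hgB).trans ?_
    rw [ENNReal.ofReal_mul hCγ0]
    refine mul_le_mul' le_rfl (le_trans (le_of_eq ?_) hdγ)
    rw [← lintegral_indicator hΩm]
    refine lintegral_congr fun x => ?_
    by_cases hx : x ∈ Ω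
    · rw [hg, Set.indicator_of_mem hx, Set.indicator_of_mem hx,
        ← ENNReal.ofReal_rpow_of_nonneg (norm_nonneg _) hγ0.le, ofReal_norm]
    · rw [hg, Set.indicator_of_notMem hx, Set.indicator_of_notMem hx, ENNReal.zero_rpow_of_pos hγ0]
  set h : E → ℝ := Ω.indicator fun z => ‖w z‖ with hh
  have hhm : Measurable h := by
    classical
    rw [hh, ← Set.piecewise_eq_indicator]
    exact hw.continuousOn.norm.measurable_piecewise continuousOn_const hΩm
  have hh0 : ∀ x, 0 ≤ h x := fun x => Set.indicator_nonneg (fun _ _ => norm_nonneg _) x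
  have hhw : ∀ x ∈ Ω, h x = ‖w x‖ := fun x hx => Set.indicator_of_mem hx _
  set G : E → ℝ := fun x => K⁻¹ * (A * (M x).toReal + ε⁻¹ * h x) with hG
  set H : E → ℝ := fun x => K⁻¹ * h x with hH
  have hG0 : ∀ x, 0 ≤ G x := fun x => by
    have := hh0 x
    have : 0 ≤ (M x).toReal := toReal_nonneg
    positivity
  have hH0 : ∀ x, 0 ≤ H x := fun x => mul_nonneg (inv_nonneg.2 hK.le) (hh0 x)
  have hGm : Measurable G := by
    have := hMm.ennreal_toReal
    simp only [hG]; fun_prop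
  have hHm : Measurable H := hhm.const_mul _
  have htri : ∀ x ∈ Ω, ∀ y ∈ Ω, ‖w x - w y‖ ≤ h x + h y := fun x hx y hy => by
    rw [hhw x hx, hhw y hy]; exact norm_sub_le _ _
  have h1 : ∀ x ∈ Ω, ∀ y ∈ Ω, ‖w x - w y‖ ≤ K * (‖x - y‖ * (G x + G y)) := by
    intro x hx y hy
    have hKG : K * (‖x - y‖ * (G x + G y)) =
        ‖x - y‖ * (A * ((M x).toReal + (M y).toReal)) + ‖x - y‖ * ε⁻¹ * (h x + h y) := by
      simp only [hG]; field_simp; ring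
    have hM2 : 0 ≤ (M x).toReal + (M y).toReal := by positivity
    have hh2 : 0 ≤ h x + h y := add_nonneg (hh0 x) (hh0 y)
    rw [hKG]
    rcases eq_or_ne x y with rfl | hxy
    · simp
    rcases lt_or_ge (dist x y) ε with hd | hd
    · obtain ⟨c, hcx, hcy, hsx, hsy⟩ := hgeo x hx y hy hxy hd
      have hle := enorm_sub_le_dyadicMaximal μ (Λ := 5) (R := R) hΩo hw hgm hgle (dist_pos.2 hxy)
        (by norm_num) hcx hcy (by rw [hR]; gcongr) hsx hsy
      simp only [← hM, ← hA] at hle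
      rw [← ENNReal.ofReal_toReal (hMfin x), ← ENNReal.ofReal_toReal (hMfin y),
        ← ENNReal.ofReal_add toReal_nonneg toReal_nonneg, ← ENNReal.ofReal_mul dist_nonneg,
        ← ENNReal.ofReal_mul hA0.le, ← ofReal_norm,
        ENNReal.ofReal_le_ofReal_iff (by positivity), dist_eq_norm] at hle
      have : 0 ≤ ‖x - y‖ * ε⁻¹ * (h x + h y) := by positivity
      nlinarith
    · have : 0 ≤ ‖x - y‖ * (A * ((M x).toReal + (M y).toReal)) := by positivity
      have h1 : 1 ≤ ‖x - y‖ * ε⁻¹ := by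
        rw [← dist_eq_norm, ← div_eq_mul_inv, one_le_div hε]; exact hd
      nlinarith [htri x hx y hy, mul_le_mul_of_nonneg_right h1 hh2]
  have h2 : ∀ x ∈ Ω, ∀ y ∈ Ω, ‖w x - w y‖ ≤ K * (H x + H y) := by
    intro x hx y hy
    refine (htri x hx y hy).trans_eq ?_
    simp only [hH]; field_simp
  have hscale : ∀ q : ℝ, ENNReal.ofReal ((K⁻¹) ^ q) * ENNReal.ofReal (K ^ q) = 1 := fun q => by
    rw [← ENNReal.ofReal_mul (by positivity), ← Real.mul_rpow (by positivity) hK.le,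
      inv_mul_cancel₀ hK.ne', Real.one_rpow, ENNReal.ofReal_one]
  have hhγ : ∀ q : ℝ, ∫⁻ x in Ω, ENNReal.ofReal (h x ^ q) ∂μ =
      ∫⁻ x in Ω, ENNReal.ofReal (‖w x‖ ^ q) ∂μ := fun q =>
    setLIntegral_congr_fun hΩm fun x hx => by simp only [hhw x hx]
  have hHint : ∫⁻ x in Ω, ENNReal.ofReal (H x ^ δ) ∂μ ≤ 1 := by
    calc ∫⁻ x in Ω, ENNReal.ofReal (H x ^ δ) ∂μ
        = ENNReal.ofReal ((K⁻¹) ^ δ) * ∫⁻ x in Ω, ENNReal.ofReal (h x ^ δ) ∂μ := by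
          rw [← lintegral_const_mul' _ _ ENNReal.ofReal_ne_top]
          refine lintegral_congr fun x => ?_
          rw [← ENNReal.ofReal_mul (by positivity), ← Real.mul_rpow (by positivity) (hh0 x)]
      _ ≤ ENNReal.ofReal ((K⁻¹) ^ δ) * ENNReal.ofReal (K ^ δ) := by
          rw [hhγ]; exact mul_le_mul' le_rfl hwδ
      _ = 1 := hscale δ
  have hGint : ∫⁻ x in Ω, ENNReal.ofReal (G x ^ γ) ∂μ ≤ ENNReal.ofReal T := by
    have hpt : ∀ x, ENNReal.ofReal (G x ^ γ) ≤ ENNReal.ofReal ((K⁻¹) ^ γ) *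
        (ENNReal.ofReal (2 ^ (γ - 1)) * (ENNReal.ofReal (A ^ γ) * M x ^ γ +
          ENNReal.ofReal ((ε⁻¹) ^ γ) * ENNReal.ofReal (h x ^ γ))) := by
      intro x
      have hMx : M x ^ γ = ENNReal.ofReal ((M x).toReal ^ γ) := by
        rw [← ENNReal.ofReal_rpow_of_nonneg toReal_nonneg hγ0.le, ENNReal.ofReal_toReal (hMfin x)]
      have hMt : 0 ≤ (M x).toReal := toReal_nonneg
      have hhx := hh0 x
      rw [hMx, ← ENNReal.ofReal_mul (by positivity), ← ENNReal.ofReal_mul (by positivity),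
        ← ENNReal.ofReal_add (by positivity) (by positivity), ← ENNReal.ofReal_mul (by positivity),
        ← ENNReal.ofReal_mul (by positivity)]
      refine ENNReal.ofReal_le_ofReal ?_
      simp only [hG]
      rw [Real.mul_rpow (by positivity) (by positivity), ← Real.mul_rpow hA0.le hMt,
        ← Real.mul_rpow (by positivity) hhx]
      refine mul_le_mul_of_nonneg_left ?_ (by positivity)
      exact mod_cast NNReal.rpow_add_le_mul_rpow_add_rpow ⟨A * (M x).toReal, by positivity⟩
        ⟨ε⁻¹ * h x, by positivity⟩ hγ.le
    calc ∫⁻ x in Ω, ENNReal.ofReal (G x ^ γ) ∂μ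
        ≤ ∫⁻ x in Ω, ENNReal.ofReal ((K⁻¹) ^ γ) *
          (ENNReal.ofReal (2 ^ (γ - 1)) * (ENNReal.ofReal (A ^ γ) * M x ^ γ +
            ENNReal.ofReal ((ε⁻¹) ^ γ) * ENNReal.ofReal (h x ^ γ))) ∂μ := lintegral_mono hpt
      _ = ENNReal.ofReal ((K⁻¹) ^ γ) * (ENNReal.ofReal (2 ^ (γ - 1)) *
            (ENNReal.ofReal (A ^ γ) * ∫⁻ x in Ω, M x ^ γ ∂μ +
              ENNReal.ofReal ((ε⁻¹) ^ γ) * ∫⁻ x in Ω, ENNReal.ofReal (h x ^ γ) ∂μ)) := by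
          rw [lintegral_const_mul' _ _ ENNReal.ofReal_ne_top,
            lintegral_const_mul' _ _ ENNReal.ofReal_ne_top,
            lintegral_add_left ((hMm.pow_const γ).const_mul _),
            lintegral_const_mul' _ _ ENNReal.ofReal_ne_top,
            lintegral_const_mul' _ _ ENNReal.ofReal_ne_top]
      _ ≤ ENNReal.ofReal ((K⁻¹) ^ γ) * (ENNReal.ofReal (2 ^ (γ - 1)) *
            (ENNReal.ofReal (A ^ γ) * ENNReal.ofReal (Cγ * K ^ γ) +
              ENNReal.ofReal ((ε⁻¹) ^ γ) * ENNReal.ofReal (K ^ γ))) := by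
          rw [hhγ]
          gcongr
          exact (setLIntegral_le_lintegral _ _).trans hMint
      _ = (ENNReal.ofReal ((K⁻¹) ^ γ) * ENNReal.ofReal (K ^ γ)) * (ENNReal.ofReal (2 ^ (γ - 1)) *
            (ENNReal.ofReal (A ^ γ) * ENNReal.ofReal Cγ + ENNReal.ofReal ((ε⁻¹) ^ γ))) := by
          rw [ENNReal.ofReal_mul hCγ0]; ring
      _ = ENNReal.ofReal T := by
          rw [hscale, one_mul, ← ENNReal.ofReal_mul (by positivity),
            ← ENNReal.ofReal_add (by positivity) (by positivity),
            ← ENNReal.ofReal_mul (by positivity)]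
  have hsum : ∫⁻ x in Ω, ENNReal.ofReal (1 + G x ^ γ + H x ^ δ) ∂μ ≤
      ENNReal.ofReal ((μ Ω).toReal + T + 1) := by
    have hpt : ∀ x, ENNReal.ofReal (1 + G x ^ γ + H x ^ δ) =
        1 + ENNReal.ofReal (G x ^ γ) + ENNReal.ofReal (H x ^ δ) := fun x => by
      have e1 := Real.rpow_nonneg (hG0 x) γ
      have e2 := Real.rpow_nonneg (hH0 x) δ
      rw [ENNReal.ofReal_add (by positivity) e2, ENNReal.ofReal_add zero_le_one e1,
        ENNReal.ofReal_one]
    have hGγ : Measurable fun x => (1 : ℝ≥0∞) + ENNReal.ofReal (G x ^ γ) := by fun_prop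
    simp_rw [hpt]
    rw [lintegral_add_left hGγ,
      lintegral_add_left measurable_const, setLIntegral_one,
      ENNReal.ofReal_add (by positivity) zero_le_one, ENNReal.ofReal_add toReal_nonneg hT0,
      ENNReal.ofReal_toReal hΩfin, ENNReal.ofReal_one]
    gcongr
  calc _ ≤ ENNReal.ofReal (C₀ * K ^ r) *
          ∫⁻ x in Ω, ENNReal.ofReal (1 + G x ^ γ + H x ^ δ) ∂μ :=
        hGag Ω w G H K hΩm hGm hHm hG0 hH0 hK.le h1 h2
    _ ≤ ENNReal.ofReal (C₀ * K ^ r) * ENNReal.ofReal ((μ Ω).toReal + T + 1) :=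
        mul_le_mul' le_rfl hsum
    _ = _ := by
        rw [← ENNReal.ofReal_mul (by positivity)]
        congr 1
        ring

end FractionalInterpolation

section SobolevNorms

open Metric ENNReal Module

theorem ofReal_integral_le_lintegral {α : Type*} [MeasurableSpace α] {μ : Measure α} {g : α → ℝ}
    (hg : ∀ x, 0 ≤ g x) : ENNReal.ofReal (∫ x, g x ∂μ) ≤ ∫⁻ x, ENNReal.ofReal (g x) ∂μ := by
  have h := enorm_integral_le_lintegral_enorm (μ := μ) g
  rw [Real.enorm_of_nonneg (integral_nonneg hg)] at h
  exact h.trans_eq (lintegral_congr fun x => Real.enorm_of_nonneg (hg x))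

/-- The derivatives of a function which is smooth up to the boundary of a bounded open set are
bounded. -/
theorem exists_norm_iteratedFDeriv_le {E F : Type*} [NormedAddCommGroup E] [NormedSpace ℝ E]
    [ProperSpace E] [NormedAddCommGroup F] [NormedSpace ℝ F] {Ω : Set E} (hΩo : IsOpen Ω)
    (hΩb : Bornology.IsBounded Ω) {u : E → F} (hu : ContDiffOn ℝ (⊤ : ℕ∞) u (closure Ω)) (j : ℕ) :
    ∃ B, ∀ x ∈ Ω, ‖iteratedFDeriv ℝ j u x‖ ≤ B := by
  suffices h : ∃ B, ∀ x ∈ closure Ω ∩ Ω, ‖iteratedFDeriv ℝ j u x‖ ≤ B by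
    obtain ⟨B, hB⟩ := h
    exact ⟨B, fun x hx => hB x ⟨subset_closure hx, hx⟩⟩
  refine hΩb.isCompact_closure.induction_on
    (p := fun s => ∃ B, ∀ x ∈ s ∩ Ω, ‖iteratedFDeriv ℝ j u x‖ ≤ B) ⟨0, by simp⟩ ?_ ?_ ?_
  · rintro s t hst ⟨B, hB⟩
    exact ⟨B, fun x hx => hB x ⟨hst hx.1, hx.2⟩⟩
  · rintro s t ⟨B, hB⟩ ⟨B', hB'⟩
    refine ⟨max B B', fun x hx => ?_⟩
    rcases hx.1 with h | h
    · exact (hB x ⟨h, hx.2⟩).trans (le_max_left _ _)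
    · exact (hB' x ⟨h, hx.2⟩).trans (le_max_right _ _)
  · intro x hx
    obtain ⟨v, hv, p, hp⟩ := contDiffWithinAt_nat.1
      ((hu x hx).of_le (m := (j : WithTop ℕ∞)) (mod_cast le_top))
    rw [Set.insert_eq_of_mem hx] at hv
    have hxv : x ∈ v := mem_of_mem_nhdsWithin hx hv
    have hlt : ∀ᶠ y in 𝓝[v] x, ‖p y j‖ < ‖p x j‖ + 1 :=
      (hp.cont j le_rfl x hxv).norm.eventually_lt_const (lt_add_one _)
    have hW := inter_mem hv (nhdsWithin_le_of_mem hv hlt)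
    obtain ⟨U, hU, hxU, hUW⟩ := mem_nhdsWithin.1 hW
    refine ⟨U ∩ closure Ω, inter_mem (mem_nhdsWithin_of_mem_nhds (hU.mem_nhds hxU))
      self_mem_nhdsWithin, ‖p x j‖ + 1, ?_⟩
    rintro y ⟨⟨hyU, hyc⟩, hy⟩
    have hsub : U ∩ Ω ⊆ v := fun z hz => (hUW ⟨hz.1, subset_closure hz.2⟩).1
    have ho : IsOpen (U ∩ Ω) := hU.inter hΩo
    have heq := (hp.mono hsub).eq_iteratedFDerivWithin_of_uniqueDiffOn (m := j) le_rfl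
      ho.uniqueDiffOn ⟨hyU, hy⟩
    rw [iteratedFDerivWithin_of_isOpen j ho ⟨hyU, hy⟩] at heq
    rw [← heq]
    exact (hUW ⟨hyU, hyc⟩).2.le

theorem contDiffOn_iteratedFDeriv {E F : Type*} [NormedAddCommGroup E] [NormedSpace ℝ E]
    [NormedAddCommGroup F] [NormedSpace ℝ F] {Ω : Set E} (hΩo : IsOpen Ω)
    {u : E → F} (hu : ContDiffOn ℝ (⊤ : ℕ∞) u Ω) (j : ℕ) :
    ContDiffOn ℝ 1 (iteratedFDeriv ℝ j u) Ω := by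
  intro x hx
  have h := hu.contDiffAt (hΩo.mem_nhds hx)
  exact (h.iteratedFDeriv_right (i := j) (m := 1) (mod_cast le_top)).contDiffWithinAt

theorem lintegral_rpow_le_of_integral_rpow_le {α F : Type*} [MeasurableSpace α]
    [TopologicalSpace α] [OpensMeasurableSpace α] {μ : Measure α} [NormedAddCommGroup F]
    {Ω : Set α} (hΩo : IsOpen Ω) (hΩ : μ Ω ≠ ∞) {w : α → F} (hw : ContinuousOn w Ω)
    {B : ℝ} (hB : ∀ x ∈ Ω, ‖w x‖ ≤ B) {p K : ℝ} (hp : 0 < p)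
    (h : (∫ x in Ω, ‖w x‖ ^ p ∂μ) ^ (1 / p) ≤ K) :
    ∫⁻ x in Ω, ENNReal.ofReal (‖w x‖ ^ p) ∂μ ≤ ENNReal.ofReal (K ^ p) := by
  have h0 : ∀ x, 0 ≤ ‖w x‖ ^ p := fun x => by positivity
  have hc : ContinuousOn (fun x => ‖w x‖ ^ p) Ω := hw.norm.rpow_const fun _ _ => Or.inr hp.le
  have h_int : IntegrableOn (fun x => ‖w x‖ ^ p) Ω μ := by
    refine IntegrableOn.of_bound hΩ.lt_top (hc.aestronglyMeasurable hΩo.measurableSet) (B ^ p) ?_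
    filter_upwards [ae_restrict_mem hΩo.measurableSet] with x hx
    rw [Real.norm_of_nonneg (h0 x)]
    exact Real.rpow_le_rpow (norm_nonneg _) (hB x hx) hp.le
  rw [← ofReal_integral_eq_lintegral_ofReal h_int (Eventually.of_forall h0)]
  refine ENNReal.ofReal_le_ofReal ?_
  have hI : 0 ≤ ∫ x in Ω, ‖w x‖ ^ p ∂μ := integral_nonneg h0
  have h' := Real.rpow_le_rpow (by positivity) h hp.le
  rwa [← Real.rpow_mul hI, one_div, inv_mul_cancel₀ hp.ne', Real.rpow_one] at h'

theorem integral_rpow_le_of_lintegral_rpow_le {α F : Type*} [MeasurableSpace α]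
    {μ : Measure α} [NormedAddCommGroup F] {Ω : Set α} (hΩ : μ Ω ≠ ∞) {w : α → F}
    {r p K : ℝ} (hr : 0 < r) (hrp : r ≤ p) (hK : 0 < K)
    (h : ∫⁻ x in Ω, ENNReal.ofReal (‖w x‖ ^ p) ∂μ ≤ ENNReal.ofReal (K ^ p)) :
    (∫ x in Ω, ‖w x‖ ^ r ∂μ) ^ (1 / r) ≤ ((μ Ω).toReal + 1) ^ (1 / r) * K := by
  have h0 : ∀ x, 0 ≤ ‖w x‖ ^ r := fun x => by positivity
  have hpt : ∀ x, ENNReal.ofReal (‖w x‖ ^ r) ≤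
      ENNReal.ofReal (K ^ r) * (1 + ENNReal.ofReal (K⁻¹ ^ p) * ENNReal.ofReal (‖w x‖ ^ p)) := by
    intro x
    rw [← ENNReal.ofReal_mul (by positivity), ← ENNReal.ofReal_one,
      ← ENNReal.ofReal_add zero_le_one (by positivity), ← ENNReal.ofReal_mul (by positivity),
      ← Real.mul_rpow (by positivity) (norm_nonneg _)]
    refine ENNReal.ofReal_le_ofReal ?_
    have ha : 0 ≤ K⁻¹ * ‖w x‖ := by positivity
    have hwx : ‖w x‖ ^ r = K ^ r * (K⁻¹ * ‖w x‖) ^ r := by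
      rw [← Real.mul_rpow hK.le ha, mul_inv_cancel_left₀ hK.ne']
    rw [hwx]
    refine mul_le_mul_of_nonneg_left ?_ (by positivity)
    rcases le_total (K⁻¹ * ‖w x‖) 1 with h1 | h1
    · have := Real.rpow_le_one ha h1 hr.le
      have : 0 ≤ (K⁻¹ * ‖w x‖) ^ p := by positivity
      linarith
    · have := Real.rpow_le_rpow_of_exponent_le h1 hrp
      linarith
  have hI : ENNReal.ofReal (∫ x in Ω, ‖w x‖ ^ r ∂μ) ≤
      ENNReal.ofReal (((μ Ω).toReal + 1) * K ^ r) := by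
    calc _ ≤ ∫⁻ x in Ω, ENNReal.ofReal (‖w x‖ ^ r) ∂μ := ofReal_integral_le_lintegral h0
      _ ≤ ∫⁻ x in Ω, ENNReal.ofReal (K ^ r) *
          (1 + ENNReal.ofReal (K⁻¹ ^ p) * ENNReal.ofReal (‖w x‖ ^ p)) ∂μ := lintegral_mono hpt
      _ = ENNReal.ofReal (K ^ r) * (μ Ω + ENNReal.ofReal (K⁻¹ ^ p) *
          ∫⁻ x in Ω, ENNReal.ofReal (‖w x‖ ^ p) ∂μ) := by
        rw [lintegral_const_mul' _ _ ENNReal.ofReal_ne_top, lintegral_add_left measurable_const,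
          lintegral_const_mul' _ _ ENNReal.ofReal_ne_top, setLIntegral_one]
      _ ≤ ENNReal.ofReal (K ^ r) * (μ Ω + ENNReal.ofReal (K⁻¹ ^ p) * ENNReal.ofReal (K ^ p)) := by
        gcongr
      _ = _ := by
        rw [← ENNReal.ofReal_mul (by positivity), ← Real.mul_rpow (by positivity) hK.le,
          inv_mul_cancel₀ hK.ne', Real.one_rpow, mul_comm ((μ Ω).toReal + 1),
          ENNReal.ofReal_mul (by positivity), ENNReal.ofReal_add toReal_nonneg zero_le_one,
          ENNReal.ofReal_toReal hΩ]
  rw [ENNReal.ofReal_le_ofReal_iff (by positivity)] at hI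
  refine (Real.rpow_le_rpow (integral_nonneg h0) hI (by positivity)).trans_eq ?_
  rw [Real.mul_rpow (by positivity) (by positivity), ← Real.rpow_mul hK.le, mul_one_div,
    div_self hr.ne', Real.rpow_one]

variable {N : ℕ} {F : Type*} [NormedAddCommGroup F] [NormedSpace ℝ F] {Ω : Set (Euc N)}

theorem sobNorm_natCast (Ω : Set (Euc N)) (k : ℕ) (p : ℝ) (u : Euc N → F) :
    sobNorm Ω (k : ℝ) p u = intSobNorm Ω k p u := by
  rw [sobNorm, if_pos ⟨k, rfl⟩, Nat.floor_natCast]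

theorem intSobNorm_nonneg (Ω : Set (Euc N)) (k : ℕ) (p : ℝ) (u : Euc N → F) :
    0 ≤ intSobNorm Ω k p u :=
  Finset.sum_nonneg fun _ _ => Real.rpow_nonneg (integral_nonneg fun _ => by positivity) _

theorem lintegral_iteratedFDeriv_rpow_le (hΩo : IsOpen Ω) (hΩb : Bornology.IsBounded Ω)
    {u : Euc N → F} (hu : ContDiffOn ℝ (⊤ : ℕ∞) u (closure Ω)) {p K : ℝ} (hp : 0 < p) {j k : ℕ}
    (hjk : j ≤ k) (h : intSobNorm Ω k p u ≤ K) :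
    ∫⁻ x in Ω, ENNReal.ofReal (‖iteratedFDeriv ℝ j u x‖ ^ p) ≤ ENNReal.ofReal (K ^ p) := by
  obtain ⟨B, hB⟩ := exists_norm_iteratedFDeriv_le hΩo hΩb hu j
  refine lintegral_rpow_le_of_integral_rpow_le hΩo hΩb.measure_lt_top.ne
    (contDiffOn_iteratedFDeriv hΩo (hu.mono subset_closure) j).continuousOn hB hp (le_trans ?_ h)
  exact Finset.single_le_sum
    (f := fun j => (∫ x in Ω, ‖iteratedFDeriv ℝ j u x‖ ^ p) ^ (1 / p))
    (fun _ _ => Real.rpow_nonneg (integral_nonneg fun _ => by positivity) _)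
    (Finset.mem_range.2 (by omega))

theorem intSobNorm_le_mul (hΩb : Bornology.IsBounded Ω) {u : Euc N → F} {r p K : ℝ} (hr : 0 < r)
    (hrp : r ≤ p) (hK : 0 < K) {k : ℕ}
    (h : ∀ j ≤ k, ∫⁻ x in Ω, ENNReal.ofReal (‖iteratedFDeriv ℝ j u x‖ ^ p) ≤
      ENNReal.ofReal (K ^ p)) :
    intSobNorm Ω k r u ≤ (k + 1) * ((volume Ω).toReal + 1) ^ (1 / r) * K := by
  refine (Finset.sum_le_card_nsmul _ _ (((volume Ω).toReal + 1) ^ (1 / r) * K) fun j hj =>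
    integral_rpow_le_of_lintegral_rpow_le hΩb.measure_lt_top.ne hr hrp hK
      (h j (Nat.lt_succ_iff.1 (Finset.mem_range.1 hj)))).trans_eq ?_
  rw [Finset.card_range, nsmul_eq_mul]
  push_cast
  ring

/-- The fractional Sobolev norm of order `k + θ` is controlled by those of orders `k + 1`
and `k`. -/
theorem exists_sobNorm_add_le (hN : 0 < N) (hΩ : IsSmoothDomain Ω) [CompleteSpace F]
    {θ r γ δ : ℝ} (hθ0 : 0 < θ) (hθ1 : θ < 1) (hr : 0 < r) (hγ : 1 < γ) (hδ : 0 < δ)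
    (hexp : θ * r / γ + (1 - θ) * r / δ ≤ 1) (k : ℕ) :
    ∃ C : ℝ, 0 < C ∧ ∀ u : Euc N → F, ContDiffOn ℝ (⊤ : ℕ∞) u (closure Ω) → ∀ K, 0 < K →
      intSobNorm Ω (k + 1) γ u ≤ K → intSobNorm Ω k δ u ≤ K →
      sobNorm Ω (k + θ) r u ≤ C * K := by
  obtain ⟨hΩo, hΩb, f, hf, hΩf, hfr⟩ := hΩ
  have : Nontrivial (Euc N) := by
    have : Nonempty (Fin N) := ⟨⟨0, hN⟩⟩
    infer_instance
  have hγ0 : 0 < γ := by linarith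
  obtain ⟨C, hC, hGN⟩ := exists_lintegral_gagliardo_le_of_sublevel
    (F := ContinuousMultilinearMap ℝ (fun _ : Fin k => Euc N) F) (volume : Measure (Euc N))
    (hf.of_le (mod_cast le_top)) hΩo hΩb hΩf hfr hθ0 hθ1 hr hγ hδ hexp
  set D : ℝ := (k + 1) * ((volume Ω).toReal + 1) ^ (1 / r) with hD
  have hD0 : 0 < D := by positivity
  refine ⟨D + C ^ (1 / r), by positivity, fun u hu K hK hKγ hKδ => ?_⟩
  have hγj : ∀ j ≤ k + 1, _ := fun j hj =>
    lintegral_iteratedFDeriv_rpow_le hΩo hΩb hu hγ0 hj hKγ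
  have hδj : ∀ j ≤ k, _ := fun j hj =>
    lintegral_iteratedFDeriv_rpow_le hΩo hΩb hu hδ hj hKδ
  have hrle : r ≤ γ ∨ r ≤ δ := by
    by_contra! hlt
    have h1 : θ < θ * r / γ := by
      rw [lt_div_iff₀ hγ0]; exact mul_lt_mul_of_pos_left hlt.1 hθ0
    have h2 : 1 - θ < (1 - θ) * r / δ := by
      rw [lt_div_iff₀ hδ]; exact mul_lt_mul_of_pos_left hlt.2 (by linarith)
    linarith
  have hlow : intSobNorm Ω k r u ≤ D * K := by
    rcases hrle with h | h
    · exact intSobNorm_le_mul hΩb hr h hK fun j hj => hγj j (by omega)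
    · exact intSobNorm_le_mul hΩb hr h hK hδj
  have hfloor : ⌊(k : ℝ) + θ⌋₊ = k := by
    rw [Nat.floor_eq_iff (by positivity)]
    constructor <;> linarith
  have hnot : ¬ ∃ l : ℕ, (k : ℝ) + θ = l := by
    rintro ⟨l, hl⟩
    rw [hl, Nat.floor_natCast] at hfloor
    subst hfloor
    linarith
  obtain ⟨B, hB⟩ := exists_norm_iteratedFDeriv_le hΩo hΩb hu (k + 1)
  have hG := hGN (iteratedFDeriv ℝ k u) B K
    (contDiffOn_iteratedFDeriv hΩo (hu.mono subset_closure) k)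
    (fun x hx => by rw [norm_fderiv_iteratedFDeriv]; exact hB x hx) hK (hγj k (by omega))
    (by simp_rw [norm_fderiv_iteratedFDeriv]; exact hγj (k + 1) le_rfl) (hδj k le_rfl)
  rw [finrank_euclideanSpace_fin] at hG
  rw [sobNorm, if_neg hnot, hfloor, add_sub_cancel_left, add_mul]
  have hg0 : ∀ x y : Euc N, 0 ≤ ‖iteratedFDeriv ℝ k u x - iteratedFDeriv ℝ k u y‖ ^ r /
      ‖x - y‖ ^ ((N : ℝ) + θ * r) := fun x y => by positivity
  have hI : (∫ x in Ω, ∫ y in Ω, ‖iteratedFDeriv ℝ k u x - iteratedFDeriv ℝ k u y‖ ^ r /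
      ‖x - y‖ ^ ((N : ℝ) + θ * r)) ≤ C * K ^ r := by
    rw [← ENNReal.ofReal_le_ofReal_iff (by positivity)]
    exact (ofReal_integral_le_lintegral fun x => integral_nonneg (hg0 x)).trans
      ((lintegral_mono fun x => ofReal_integral_le_lintegral (hg0 x)).trans hG)
  refine add_le_add hlow ?_
  refine (Real.rpow_le_rpow (integral_nonneg fun x => integral_nonneg (hg0 x)) hI
    (by positivity)).trans_eq ?_
  rw [Real.mul_rpow hC (by positivity), ← Real.rpow_mul hK.le, mul_one_div, div_self hr.ne',
    Real.rpow_one]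

end SobolevNorms

/-- Remark (i): the continuous embedding
`W^{m-[m/r],γ}(Ω,ℝ^n) ∩ W^{m-[m/r]-1,δ}(Ω,ℝ^n) ⊂ W^{m-m/r,r}(Ω,ℝ^n)` when
`(r-t)/γ + t/δ ≤ 1`, `t = m mod r`. -/
theorem stmt17 (N n m r : ℕ) (hN : 2 ≤ N) (hn : 1 ≤ n) (hm : 1 ≤ m)
    (hr1 : 1 < r) (hrN : r ≤ N)
    (Ω : Set (Euc N)) (hΩ : IsSmoothDomain Ω)
    (γ δ : ℝ) (hγ1 : 1 < γ) (hδ1 : 1 < δ)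
    (hcond : ((r : ℝ) - (m % r : ℕ)) / γ + ((m % r : ℕ) : ℝ) / δ ≤ 1) :
    ∃ C : ℝ, 0 < C ∧
      ∀ u : Euc N → Fin n → ℝ, ContDiffOn ℝ (⊤ : ℕ∞) u (closure Ω) →
        sobNorm Ω ((m : ℝ) - (m : ℝ) / r) r u ≤
          C * (sobNorm Ω ((m - m / r : ℕ) : ℝ) γ u +
            sobNorm Ω ((m - m / r - 1 : ℕ) : ℝ) δ u) := by
  have hr0 : (0 : ℝ) < r := by positivity
  have hle : m / r < m := Nat.div_lt_self (by omega) hr1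
  have hdm : (r : ℝ) * (m / r : ℕ) + (m % r : ℕ) = m := mod_cast Nat.div_add_mod m r
  suffices h : ∃ C : ℝ, 0 < C ∧ ∀ u : Euc N → Fin n → ℝ,
      ContDiffOn ℝ (⊤ : ℕ∞) u (closure Ω) → ∀ K, 0 < K →
      intSobNorm Ω (m - m / r) γ u ≤ K → intSobNorm Ω (m - m / r - 1) δ u ≤ K →
      sobNorm Ω ((m : ℝ) - (m : ℝ) / r) r u ≤ C * K by
    obtain ⟨C, hC, h⟩ := h
    refine ⟨C, hC, fun u hu => ?_⟩
    rw [sobNorm_natCast, sobNorm_natCast, ← div_le_iff₀' hC]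
    have h1 := intSobNorm_nonneg Ω (m - m / r) γ u
    have h2 := intSobNorm_nonneg Ω (m - m / r - 1) δ u
    refine le_of_forall_gt_imp_ge_of_dense fun K hK => ?_
    rw [div_le_iff₀' hC]
    exact h u hu K (by linarith) (by linarith) (by linarith)
  rcases Nat.eq_zero_or_pos (m % r) with ht | ht
  · have hs : (m : ℝ) - (m : ℝ) / r = ((m - m / r : ℕ) : ℝ) := by
      rw [Nat.cast_sub hle.le, ← hdm, ht]
      push_cast
      field_simp
      ring
    have hrγ : (r : ℝ) ≤ γ := by
      rw [ht, Nat.cast_zero, sub_zero, zero_div, add_zero, div_le_one (by linarith)] at hcond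
      exact hcond
    refine ⟨((m - m / r : ℕ) + 1) * ((volume Ω).toReal + 1) ^ (1 / (r : ℝ)), by positivity,
      fun u hu K hK hKγ _ => ?_⟩
    rw [hs, sobNorm_natCast]
    exact intSobNorm_le_mul hΩ.2.1 hr0 hrγ hK fun j hj =>
      lintegral_iteratedFDeriv_rpow_le hΩ.1 hΩ.2.1 hu (by linarith) hj hKγ
  · have htr : ((m % r : ℕ) : ℝ) < r := mod_cast Nat.mod_lt m (by omega)
    have ht0 : (0 : ℝ) < (m % r : ℕ) := mod_cast ht
    have hk : m - m / r = m - m / r - 1 + 1 := by omega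
    have hkr : ((m - m / r - 1 : ℕ) : ℝ) = m - (m / r : ℕ) - 1 := by
      rw [Nat.cast_sub (by omega), Nat.cast_sub hle.le, Nat.cast_one]
    have hs : (m : ℝ) - (m : ℝ) / r =
        ((m - m / r - 1 : ℕ) : ℝ) + (1 - ((m % r : ℕ) : ℝ) / r) := by
      rw [hkr]
      field_simp
      linarith
    rw [hs]
    generalize m - m / r - 1 = k at hk
    rw [hk]
    refine exists_sobNorm_add_le (by omega) hΩ ?_ ?_ hr0 hγ1 (by linarith) ?_ k
    · rw [sub_pos, div_lt_one hr0]; exact htr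
    · have := div_pos ht0 hr0
      linarith
    · have e1 : (1 - ((m % r : ℕ) : ℝ) / r) * r = r - (m % r : ℕ) := by field_simp
      have e2 : (1 - (1 - ((m % r : ℕ) : ℝ) / r)) * r = (m % r : ℕ) := by field_simp; ring
      rw [e1, e2]
      exact hcond
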